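/- Let k ≥ 3 be an integer and let 0 < α₁ < α₂ < ... < α_k be integers. Let f(X) = X·(X+α₁)···(X+α_k), and let D(f) = ∏_{0 ≤ i < j ≤ k} (α_j − α_i)² with the convention α₀ = 0 (the discriminant of f up to sign). Then the number of pairs of integers (X, Y) satisfying Y² = f(X) is at most 7^{13 + 9·ω(D(f))}, where ω(n) denotes the number of distinct prime divisors of n. -/

import Mathlib

open scoped Classical

noncomputable section

/-- Homogeneous form of degree `n`: the coefficient of `T ^ n` in `((1 - y T) (1 - z T)) ^ (-n - 1)`. -/
def padeW {R : Type*} [CommRing R] (n : ℕ) (y z : R) : R :=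
  ∑ m ∈ Finset.HasAntidiagonal.antidiagonal n,
    (((n + m.1).choose n * (n + m.2).choose n : ℕ) : R) * y ^ m.1 * z ^ m.2

theorem map_padeW {R S : Type*} [CommRing R] [CommRing S] (f : R →+* S) (n : ℕ) (y z : R) :
    f (padeW n y z) = padeW n (f y) (f z) := by
  simp [padeW]

theorem padeW_mul {R : Type*} [CommRing R] (n : ℕ) (c y z : R) :
    padeW n (c * y) (c * z) = c ^ n * padeW n y z := by
  unfold padeW
  rw [Finset.mul_sum]
  refine Finset.sum_congr rfl fun m hm => ?_
  rw [← Finset.HasAntidiagonal.mem_antidiagonal.1 hm, pow_add]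
  ring

theorem padeW_zero {R : Type*} [CommRing R] (y z : R) : padeW 0 y z = 1 := by
  simp [padeW]

theorem padeW_zero_left {R : Type*} [CommRing R] (n : ℕ) (z : R) :
    padeW n 0 z = ((2 * n).choose n : ℕ) * z ^ n := by
  unfold padeW
  rw [Finset.sum_eq_single (0, n)]
  · simp [two_mul]
  · rintro ⟨a, b⟩ hab hne
    have : a ≠ 0 := by
      rintro rfl
      simp at hab
      exact hne (by rw [hab])
    simp [this]
  · simp

theorem padeW_one_one_ne_zero {K : Type*} [Field K] [CharZero K] (n : ℕ) :
    padeW n (1 : K) 1 ≠ 0 := by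
  have h : padeW n (1 : K) 1 = ((∑ m ∈ Finset.HasAntidiagonal.antidiagonal n,
      (n + m.1).choose n * (n + m.2).choose n : ℕ) : K) := by
    simp [padeW]
  rw [h, Nat.cast_ne_zero]
  refine (Finset.sum_pos (fun m _ => ?_) ⟨(0, n), by simp⟩).ne'
  exact Nat.mul_pos (Nat.choose_pos (by omega)) (Nat.choose_pos (by omega))

theorem sum_choose_mul_choose_le (n : ℕ) :
    ∑ m ∈ Finset.HasAntidiagonal.antidiagonal n, (n + m.1).choose n * (n + m.2).choose n ≤ 16 ^ n := by
  calc ∑ m ∈ Finset.HasAntidiagonal.antidiagonal n, (n + m.1).choose n * (n + m.2).choose n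
      ≤ ∑ m ∈ Finset.HasAntidiagonal.antidiagonal n, 8 ^ n := by
        refine Finset.sum_le_sum fun m hm => ?_
        have h := Finset.HasAntidiagonal.mem_antidiagonal.1 hm
        calc (n + m.1).choose n * (n + m.2).choose n ≤ 2 ^ (n + m.1) * 2 ^ (n + m.2) :=
              Nat.mul_le_mul (Nat.choose_le_two_pow _ _) (Nat.choose_le_two_pow _ _)
          _ = 2 ^ (3 * n) := by rw [← pow_add]; congr 1; omega
          _ = 8 ^ n := by rw [pow_mul]; norm_num
    _ = (n + 1) * 8 ^ n := by simp
    _ ≤ 2 ^ n * 8 ^ n := Nat.mul_le_mul_right _ (Nat.lt_two_pow_self)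
    _ = 16 ^ n := by rw [← mul_pow]; norm_num

/-- Truncated inverse of `((X + p) (X + q)) ^ (n + 1)` modulo `X ^ (n + 1)`. -/
theorem exists_coeffs_inverse {K : Type*} [Field K] (n : ℕ) {p q : K} (hp : p ≠ 0) (hq : q ≠ 0) :
    ∃ c : ℕ → K, c n * (p * q) ^ (2 * n + 1) = (-1) ^ n * padeW n p q ∧
      (Polynomial.X : Polynomial K) ^ (n + 1) ∣
        (∑ m ∈ Finset.range (n + 1), Polynomial.C (c m) * Polynomial.X ^ m) *
          ((Polynomial.X + Polynomial.C p) * (Polynomial.X + Polynomial.C q)) ^ (n + 1) - 1 := by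
  have key : ∀ p : K, p ≠ 0 →
      PowerSeries.mk (fun m => ((n + m).choose n : K) * (-1) ^ m * p⁻¹ ^ m) *
        (PowerSeries.X + PowerSeries.C p) ^ (n + 1) = PowerSeries.C (p ^ (n + 1)) := by
    intro p hp
    have h := congrArg (PowerSeries.rescale (-p⁻¹))
      (PowerSeries.mk_add_choose_mul_one_sub_pow_eq_one K n)
    rw [map_mul, map_pow, map_sub, map_one, PowerSeries.rescale_X] at h
    have e1 : (1 : PowerSeries K) - PowerSeries.C (-p⁻¹) * PowerSeries.X =
        PowerSeries.C p⁻¹ * (PowerSeries.X + PowerSeries.C p) := by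
      rw [mul_add, ← map_mul, inv_mul_cancel₀ hp, map_neg, map_one]
      ring
    rw [e1, mul_pow] at h
    have e2 : PowerSeries.rescale (-p⁻¹) (PowerSeries.mk fun m => ((n + m).choose n : K)) =
        PowerSeries.mk (fun m => ((n + m).choose n : K) * (-1) ^ m * p⁻¹ ^ m) := by
      ext m
      simp only [PowerSeries.coeff_rescale, PowerSeries.coeff_mk]
      rw [neg_pow]
      ring
    rw [e2] at h
    calc _ = PowerSeries.C (p ^ (n + 1)) *
          (PowerSeries.mk (fun m => ((n + m).choose n : K) * (-1) ^ m * p⁻¹ ^ m) *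
          (PowerSeries.C p⁻¹ ^ (n + 1) * (PowerSeries.X + PowerSeries.C p) ^ (n + 1))) := by
          have e3 : PowerSeries.C (p ^ (n + 1)) * PowerSeries.C p⁻¹ ^ (n + 1) =
              (1 : PowerSeries K) := by
            rw [← map_pow, ← map_mul, ← mul_pow, mul_inv_cancel₀ hp, one_pow, map_one]
          linear_combination (-PowerSeries.mk (fun m => ((n + m).choose n : K) * (-1) ^ m * p⁻¹ ^ m) *
            (PowerSeries.X + PowerSeries.C p) ^ (n + 1)) * e3
      _ = _ := by rw [h, mul_one]
  set f : PowerSeries K := PowerSeries.C ((p * q) ^ (n + 1))⁻¹ *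
    (PowerSeries.mk (fun m => ((n + m).choose n : K) * (-1) ^ m * p⁻¹ ^ m) *
      PowerSeries.mk (fun m => ((n + m).choose n : K) * (-1) ^ m * q⁻¹ ^ m)) with hf
  have hpq : (p * q) ^ (n + 1) ≠ 0 := pow_ne_zero _ (mul_ne_zero hp hq)
  have hf1 : f * ((PowerSeries.X + PowerSeries.C p) * (PowerSeries.X + PowerSeries.C q)) ^ (n + 1)
      = 1 := by
    have h1 : PowerSeries.C ((p * q) ^ (n + 1))⁻¹ *
        (PowerSeries.C (p ^ (n + 1)) * PowerSeries.C (q ^ (n + 1))) = (1 : PowerSeries K) := by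
      rw [← map_mul, ← map_mul, ← mul_pow, inv_mul_cancel₀ hpq, map_one]
    rw [← key p hp, ← key q hq] at h1
    rw [hf, ← h1, mul_pow (PowerSeries.X + PowerSeries.C p)]
    ring
  refine ⟨fun m => PowerSeries.coeff m f, ?_, ?_⟩
  · show PowerSeries.coeff n f * _ = _
    rw [hf, PowerSeries.coeff_C_mul, PowerSeries.coeff_mul]
    simp only [PowerSeries.coeff_mk]
    unfold padeW
    rw [Finset.mul_sum, Finset.mul_sum, Finset.sum_mul, ← Finset.Nat.sum_antidiagonal_swap]
    refine Finset.sum_congr rfl fun m hm => ?_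
    have h := Finset.HasAntidiagonal.mem_antidiagonal.1 hm
    simp only [Prod.fst_swap, Prod.snd_swap]
    have e : (p * q) ^ (2 * n + 1) = (p * q) ^ (n + 1) * (p ^ m.1 * p ^ m.2 * (q ^ m.1 * q ^ m.2)) := by
      rw [← pow_add, ← pow_add, h, ← mul_pow, ← pow_add]
      congr 1
      omega
    rw [e]
    have e4 : ((-1 : K)) ^ n = (-1) ^ m.1 * (-1) ^ m.2 := by rw [← pow_add, h]
    rw [e4]
    have e5 : ((p * q) ^ (n + 1))⁻¹ * (p * q) ^ (n + 1) = 1 := inv_mul_cancel₀ hpq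
    have e6 : p⁻¹ ^ m.2 * p ^ m.2 = 1 := by rw [← mul_pow, inv_mul_cancel₀ hp, one_pow]
    have e7 : q⁻¹ ^ m.1 * q ^ m.1 = 1 := by rw [← mul_pow, inv_mul_cancel₀ hq, one_pow]
    push_cast
    calc _ = (((p * q) ^ (n + 1))⁻¹ * (p * q) ^ (n + 1)) * (p⁻¹ ^ m.2 * p ^ m.2) *
          (q⁻¹ ^ m.1 * q ^ m.1) * ((-1) ^ m.1 * (-1) ^ m.2 * (((n + m.1).choose n : K) *
          ((n + m.2).choose n : K) * p ^ m.1 * q ^ m.2)) := by ring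
      _ = _ := by rw [e5, e6, e7]; ring
  · rw [Polynomial.X_pow_dvd_iff]
    intro d hd
    have h2 : ((((∑ m ∈ Finset.range (n + 1), Polynomial.C (PowerSeries.coeff m f) *
        Polynomial.X ^ m) * ((Polynomial.X + Polynomial.C p) * (Polynomial.X + Polynomial.C q)) ^
          (n + 1) : Polynomial K)) : PowerSeries K).coeff d = (1 : PowerSeries K).coeff d := by
      rw [← hf1]
      simp only [Polynomial.coe_mul, Polynomial.coe_pow, Polynomial.coe_add, Polynomial.coe_X,
        Polynomial.coe_C]
      rw [PowerSeries.coeff_mul, PowerSeries.coeff_mul]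
      refine Finset.sum_congr rfl fun m hm => ?_
      have h := Finset.HasAntidiagonal.mem_antidiagonal.1 hm
      congr 1
      rw [Polynomial.coeff_coe, Polynomial.finsetSum_coeff]
      simp only [Polynomial.coeff_C_mul, Polynomial.coeff_X_pow, mul_ite, mul_one, mul_zero]
      rw [Finset.sum_ite_eq, if_pos (Finset.mem_range.2 (by omega))]
    rw [Polynomial.coeff_coe] at h2
    rw [Polynomial.coeff_sub, h2, PowerSeries.coeff_one, Polynomial.coeff_one]
    simp

open Polynomial in
theorem exists_partialFraction {K : Type*} [Field K] (n : ℕ) {a b c : K} (hab : a ≠ b)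
    (hac : a ≠ c) :
    ∃ V : K[X], V.natDegree ≤ n ∧
      V.coeff n * ((a - b) * (a - c)) ^ (2 * n + 1) = (-1) ^ n * padeW n (a - b) (a - c) ∧
      (X - C a) ^ (n + 1) ∣ V * ((X - C b) * (X - C c)) ^ (n + 1) - 1 := by
  obtain ⟨e, he, hd⟩ := exists_coeffs_inverse n (sub_ne_zero.2 hab) (sub_ne_zero.2 hac)
  refine ⟨∑ m ∈ Finset.range (n + 1), C (e m) * (X - C a) ^ m, ?_, ?_, ?_⟩
  · refine natDegree_sum_le_of_forall_le _ _ fun m hm => ?_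
    refine (natDegree_C_mul_le _ _).trans ?_
    rw [natDegree_pow, natDegree_X_sub_C]
    have := Finset.mem_range.1 hm
    omega
  · rw [← he, finsetSum_coeff, Finset.sum_eq_single n]
    · simp only [coeff_C_mul, sub_eq_add_neg, ← C_neg, coeff_X_add_C_pow]
      simp
    · intro m hm hne
      have := Finset.mem_range.1 hm
      rw [coeff_C_mul, sub_eq_add_neg, ← C_neg, coeff_X_add_C_pow, Nat.choose_eq_zero_of_lt (by omega)]
      simp
    · simp
  · have h := _root_.map_dvd (compRingHom (X - C a)) hd
    simp only [coe_compRingHom, sub_comp, mul_comp, pow_comp, X_comp, C_comp, add_comp, one_comp] at h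
    have e1 : (X - C a + C (a - b)) = X - C b := by rw [C_sub]; ring
    have e2 : (X - C a + C (a - c)) = X - C c := by rw [C_sub]; ring
    rw [e1, e2, Polynomial.sum_comp] at h
    simpa using h

open Polynomial in
theorem padeW_identity {K : Type*} [Field K] (n : ℕ) {x y z : K} (hx : x ≠ 0) (hy : y ≠ 0)
    (hz : z ≠ 0) (h : x + y + z = 0) :
    x ^ (2 * n + 1) * padeW n z (-y) + y ^ (2 * n + 1) * padeW n x (-z) +
      z ^ (2 * n + 1) * padeW n y (-x) = 0 := by
  have hab : (0 : K) ≠ -z := by simpa [eq_comm] using hz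
  have hac : (0 : K) ≠ y := hy.symm
  have hbc : -z ≠ y := by
    intro h'
    apply hx
    linear_combination h + h'
  obtain ⟨A, hA1, hA2, hA3⟩ := exists_partialFraction n hab hac
  obtain ⟨B, hB1, hB2, hB3⟩ := exists_partialFraction n hbc hab.symm
  obtain ⟨D, hD1, hD2, hD3⟩ := exists_partialFraction n hac.symm hbc.symm
  set a : K := 0 with ha
  set b : K := -z with hb
  set P : K[X] := A * ((X - C b) * (X - C y)) ^ (n + 1) + B * ((X - C y) * (X - C a)) ^ (n + 1) +
    D * ((X - C a) * (X - C b)) ^ (n + 1) with hP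
  have d1 : (X - C a) ^ (n + 1) ∣ P - 1 := by
    have : P - 1 = (A * ((X - C b) * (X - C y)) ^ (n + 1) - 1) + (X - C a) ^ (n + 1) *
      (B * (X - C y) ^ (n + 1) + D * (X - C b) ^ (n + 1)) := by
      rw [hP]; simp only [mul_pow]; ring
    rw [this]
    exact dvd_add hA3 (dvd_mul_right _ _)
  have d2 : (X - C b) ^ (n + 1) ∣ P - 1 := by
    have : P - 1 = (B * ((X - C y) * (X - C a)) ^ (n + 1) - 1) + (X - C b) ^ (n + 1) *
      (A * (X - C y) ^ (n + 1) + D * (X - C a) ^ (n + 1)) := by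
      rw [hP]; simp only [mul_pow]; ring
    rw [this]
    exact dvd_add hB3 (dvd_mul_right _ _)
  have d3 : (X - C y) ^ (n + 1) ∣ P - 1 := by
    have : P - 1 = (D * ((X - C a) * (X - C b)) ^ (n + 1) - 1) + (X - C y) ^ (n + 1) *
      (A * (X - C b) ^ (n + 1) + B * (X - C a) ^ (n + 1)) := by
      rw [hP]; simp only [mul_pow]; ring
    rw [this]
    exact dvd_add hD3 (dvd_mul_right _ _)
  have cop : ∀ u v : K, u ≠ v → IsCoprime ((X - C u) ^ (n + 1)) ((X - C v) ^ (n + 1)) :=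
    fun u v huv => (isCoprime_X_sub_C_of_isUnit_sub (sub_ne_zero.2 huv).isUnit).pow
  have d4 : (X - C a) ^ (n + 1) * (X - C b) ^ (n + 1) * (X - C y) ^ (n + 1) ∣ P - 1 :=
    IsCoprime.mul_dvd ((cop a y hac).mul_left (cop b y hbc))
      (IsCoprime.mul_dvd (cop a b hab) d1 d2) d3
  have hdeg : ∀ u v : K,
      (((X - C u) * (X - C v)) ^ (n + 1)).natDegree ≤ 2 * n + 2 ∧
      (((X - C u) * (X - C v)) ^ (n + 1)).coeff (2 * n + 2) = 1 := by
    intro u v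
    have hm : (((X - C u) * (X - C v)) ^ (n + 1)).Monic :=
      ((monic_X_sub_C u).mul (monic_X_sub_C v)).pow _
    have hd : (((X - C u) * (X - C v)) ^ (n + 1)).natDegree = 2 * n + 2 := by
      rw [natDegree_pow, (monic_X_sub_C u).natDegree_mul (monic_X_sub_C v)]
      simp only [natDegree_X_sub_C]
      ring
    refine ⟨hd.le, ?_⟩
    rw [← hd]
    exact hm
  have hterm : ∀ (V : K[X]) (u v : K), V.natDegree ≤ n →
      (V * ((X - C u) * (X - C v)) ^ (n + 1)).natDegree ≤ 3 * n + 2 ∧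
      (V * ((X - C u) * (X - C v)) ^ (n + 1)).coeff (3 * n + 2) = V.coeff n := by
    intro V u v hV
    obtain ⟨h1, h2⟩ := hdeg u v
    have e : 3 * n + 2 = n + (2 * n + 2) := by ring
    rw [e]
    exact ⟨natDegree_mul_le_of_le hV h1, by rw [coeff_mul_add_eq_of_natDegree_le hV h1, h2, mul_one]⟩
  have hP1 : P - 1 = 0 := by
    refine eq_zero_of_dvd_of_natDegree_lt d4 ?_
    have hm : ∀ u : K, ((X - C u) ^ (n + 1)).Monic := fun u => (monic_X_sub_C u).pow _
    rw [((hm a).mul (hm b)).natDegree_mul (hm y), (hm a).natDegree_mul (hm b)]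
    simp only [natDegree_pow, natDegree_X_sub_C]
    have : (P - 1).natDegree ≤ 3 * n + 2 := by
      refine (natDegree_sub_le _ _).trans (max_le ?_ (by simp))
      exact natDegree_add_le_of_degree_le (natDegree_add_le_of_degree_le (hterm A _ _ hA1).1
        (hterm B _ _ hB1).1) (hterm D _ _ hD1).1
    omega
  have hsum : A.coeff n + B.coeff n + D.coeff n = 0 := by
    have h0 := congrArg (fun Q : K[X] => Q.coeff (3 * n + 2)) hP1
    simp only [hP, coeff_sub, coeff_add, (hterm A _ _ hA1).2, (hterm B _ _ hB1).2,
      (hterm D _ _ hD1).2, coeff_zero, coeff_one] at h0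
    simpa using h0
  have ea : (a - b) = z := by rw [ha, hb]; ring
  have ea' : (a - y) = -y := by rw [ha]; ring
  have eb : b - y = x := by rw [hb]; linear_combination -h
  have eb' : b - a = -z := by rw [ha, hb]; ring
  have ed : y - a = y := by rw [ha]; ring
  have ed' : y - b = -x := by rw [hb]; linear_combination h
  rw [ea, ea'] at hA2
  rw [eb, eb'] at hB2
  rw [ed, ed'] at hD2
  have hs : ((-1 : K)) ^ n * (-1) ^ n = 1 := by rw [← mul_pow]; norm_num
  have ho : ((-1 : K)) ^ (2 * n + 1) = -1 := by rw [pow_succ, pow_mul]; norm_num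
  have hneg : ∀ u v : K, (u * -v) ^ (2 * n + 1) = -(u ^ (2 * n + 1) * v ^ (2 * n + 1)) := by
    intro u v
    rw [mul_neg, ← neg_one_mul, mul_pow, ho, mul_pow]
    ring
  rw [hneg] at hA2 hB2 hD2
  have h2 : (-1) ^ n * (x ^ (2 * n + 1) * padeW n z (-y) + y ^ (2 * n + 1) * padeW n x (-z) +
      z ^ (2 * n + 1) * padeW n y (-x)) = 0 := by
    linear_combination -(x ^ (2 * n + 1) * hA2 + y ^ (2 * n + 1) * hB2 + z ^ (2 * n + 1) * hD2) -
      (x ^ (2 * n + 1) * y ^ (2 * n + 1) * z ^ (2 * n + 1)) * hsum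
  exact (mul_eq_zero.1 h2).resolve_left (pow_ne_zero _ (by norm_num))

/-- The cofactor of `(x y) ^ (2 n + 1)` in the determinant of two consecutive Padé relations. -/
def padeB {R : Type*} [CommRing R] (n : ℕ) (x y z : R) : R :=
  y ^ 2 * padeW n z (-y) * padeW (n + 1) x (-z) - x ^ 2 * padeW n x (-z) * padeW (n + 1) z (-y)

theorem map_padeB {R S : Type*} [CommRing R] [CommRing S] (f : R →+* S) (n : ℕ) (x y z : R) :
    f (padeB n x y z) = padeB n (f x) (f y) (f z) := by
  simp [padeB, map_padeW]

theorem padeB_mul {R : Type*} [CommRing R] (n : ℕ) (c x y z : R) :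
    padeB n (c * x) (c * y) (c * z) = c ^ (2 * n + 3) * padeB n x y z := by
  unfold padeB
  rw [← mul_neg, ← mul_neg, padeW_mul, padeW_mul, padeW_mul, padeW_mul]
  ring

theorem padeB_cyclic {K : Type*} [Field K] (n : ℕ) {x y z : K} (hx : x ≠ 0) (hy : y ≠ 0)
    (hz : z ≠ 0) (h : x + y + z = 0) :
    x ^ (2 * n + 1) * padeB n x y z = z ^ (2 * n + 1) * padeB n y z x := by
  have h0 := padeW_identity n hx hy hz h
  have h1 := padeW_identity (n + 1) hx hy hz h
  apply mul_left_cancel₀ (pow_ne_zero (2 * n + 1) hy)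
  unfold padeB
  linear_combination (y ^ (2 * (n + 1) + 1) * padeW (n + 1) x (-z)) * h0 -
    (y ^ (2 * n + 1) * padeW n x (-z)) * h1

theorem natDegree_padeW_le {K : Type*} [Field K] (n : ℕ) {y z : Polynomial K}
    (hy : y.natDegree ≤ 1) (hz : z.natDegree ≤ 1) : (padeW n y z).natDegree ≤ n := by
  unfold padeW
  refine Polynomial.natDegree_sum_le_of_forall_le _ _ fun m hm => ?_
  have h := Finset.HasAntidiagonal.mem_antidiagonal.1 hm
  have e : n = 0 + m.1 * 1 + m.2 * 1 := by omega
  rw [e]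
  exact Polynomial.natDegree_mul_le_of_le (Polynomial.natDegree_mul_le_of_le
    (Polynomial.natDegree_natCast _).le (Polynomial.natDegree_pow_le_of_le _ hy))
    (Polynomial.natDegree_pow_le_of_le _ hz)

open Polynomial in
theorem exists_padeB_eq {K : Type*} [Field K] [CharZero K] (n : ℕ) :
    ∃ c : K, c ≠ 0 ∧ ∀ t : K, padeB n t 1 (-1 - t) = (1 + t) ^ (2 * n + 1) * (c * (t ^ 2 + t + 1)) := by
  set E : K[X] := padeB n X 1 (-1 - X) with hE
  set F : K[X] := padeB n 1 (-1 - X) X with hF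
  have evE : ∀ t : K, E.eval t = padeB n t 1 (-1 - t) := by
    intro t
    have := map_padeB (evalRingHom t) n (X : K[X]) 1 (-1 - X)
    simpa using this
  have evF : ∀ t : K, F.eval t = padeB n 1 (-1 - t) t := by
    intro t
    have := map_padeB (evalRingHom t) n (1 : K[X]) (-1 - X) X
    simpa using this
  have hEF : X ^ (2 * n + 1) * E = (-1 - X) ^ (2 * n + 1) * F := by
    have h : (X * (X + 1)) * (X ^ (2 * n + 1) * E) = (X * (X + 1)) * ((-1 - X) ^ (2 * n + 1) * F) := by
      refine Polynomial.funext fun t => ?_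
      simp only [eval_mul, eval_pow, eval_X, eval_sub, eval_neg, eval_one, eval_add, evE, evF]
      by_cases h0 : t = 0
      · simp [h0]
      by_cases h1 : t + 1 = 0
      · simp [h1]
      have h2 : -1 - t ≠ 0 := by
        intro h
        exact h1 (by linear_combination -h)
      rw [padeB_cyclic n h0 one_ne_zero h2 (by ring)]
    exact mul_left_cancel₀ (mul_ne_zero X_ne_zero (X_add_C_ne_zero (1 : K))) h
  have hdvd : (X + C (1 : K)) ^ (2 * n + 1) ∣ E := by
    have hc : IsCoprime ((X + C (1 : K)) ^ (2 * n + 1)) (X ^ (2 * n + 1)) := by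
      refine IsCoprime.pow ⟨1, -1, ?_⟩
      simp
    refine hc.dvd_of_dvd_mul_left ?_
    rw [hEF]
    refine Dvd.dvd.mul_right (pow_dvd_pow_of_dvd ⟨-1, ?_⟩ _) _
    simp
    ring
  obtain ⟨q, hq⟩ := hdvd
  have hEdeg : E.natDegree ≤ 2 * n + 3 := by
    have h1 : (1 : K[X]).natDegree ≤ 1 := by simp
    have hX : (X : K[X]).natDegree ≤ 1 := natDegree_X_le
    have hz : (-1 - X : K[X]).natDegree ≤ 1 := by
      refine (natDegree_sub_le _ _).trans (max_le ?_ hX)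
      simp
    have h1' : (-1 : K[X]).natDegree ≤ 1 := by simp
    have hz' : (-(-1 - X) : K[X]).natDegree ≤ 1 := by rwa [natDegree_neg]
    have e : 2 * n + 3 = 2 * 1 + n + (n + 1) := by ring
    rw [hE, e]
    unfold padeB
    refine (natDegree_sub_le _ _).trans (max_le ?_ ?_)
    · exact natDegree_mul_le_of_le (natDegree_mul_le_of_le (natDegree_pow_le_of_le _ h1)
        (natDegree_padeW_le _ hz h1')) (natDegree_padeW_le _ hX hz')
    · exact natDegree_mul_le_of_le (natDegree_mul_le_of_le (natDegree_pow_le_of_le _ hX)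
        (natDegree_padeW_le _ hX hz')) (natDegree_padeW_le _ hz h1')
  have hE0 : E.eval 0 ≠ 0 := by
    rw [evE]
    unfold padeB
    have e1 : padeW n (-1 - 0 : K) (-1) = (-1) ^ n * padeW n 1 1 := by
      rw [← padeW_mul]
      simp
    rw [e1, padeW_zero_left]
    simp [padeW_one_one_ne_zero, Nat.choose_eq_zero_iff]
    omega
  have hq2 : q.natDegree ≤ 2 := by
    have hm : ((X + C (1 : K)) ^ (2 * n + 1)).Monic := (monic_X_add_C _).pow _
    have hq0 : q ≠ 0 := by
      rintro rfl
      simp [hq] at hE0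
    rw [hq, hm.natDegree_mul' hq0] at hEdeg
    simp only [natDegree_pow, natDegree_X_add_C] at hEdeg
    omega
  have hqe : ∀ t : K, q.eval t = q.coeff 0 + q.coeff 1 * t + q.coeff 2 * t ^ 2 := by
    intro t
    rw [eval_eq_sum_range' (show q.natDegree < 3 by omega)]
    simp [Finset.sum_range_succ]
  have hEq : ∀ t : K, padeB n t 1 (-1 - t) = (1 + t) ^ (2 * n + 1) * q.eval t := by
    intro t
    rw [← evE, hq]
    simp [add_comm]
  have hsym : ∀ t : K, t ≠ 0 → 1 + t ≠ 0 → q.eval t = (1 + t) ^ 2 * q.eval (-(1 + t)⁻¹) := by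
    intro t h0 h1
    have h2 : -1 - t ≠ 0 := by
      intro h
      exact h1 (by linear_combination -h)
    have h3 := padeB_cyclic n h0 one_ne_zero h2 (by ring)
    have h4 : padeB n 1 (-1 - t) t = (-1 - t) ^ (2 * n + 3) *
        padeB n (-(1 + t)⁻¹) 1 (-1 - -(1 + t)⁻¹) := by
      rw [← padeB_mul]
      congr 1 <;> field_simp <;> ring
    rw [h4, hEq, hEq] at h3
    have h5 : (1 + -(1 + t)⁻¹) ^ (2 * n + 1) * (1 + t) ^ (2 * n + 1) = t ^ (2 * n + 1) := by
      rw [← mul_pow]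
      congr 1
      field_simp
      ring
    have h6 : (-1 - t) ^ (2 * n + 1) * (-1 - t) ^ (2 * n + 3) =
        (1 + t) ^ (2 * n + 1) * (1 + t) ^ (2 * n + 3) := by
      rw [← pow_add, ← pow_add, show -1 - t = -(1 + t) by ring, Even.neg_pow ⟨2 * n + 2, by ring⟩]
    apply mul_left_cancel₀ (mul_ne_zero (pow_ne_zero (2 * n + 1) h0) (pow_ne_zero (2 * n + 1) h1))
    calc _ = t ^ (2 * n + 1) * ((1 + t) ^ (2 * n + 1) * q.eval t) := by ring
      _ = _ := h3
      _ = ((-1 - t) ^ (2 * n + 1) * (-1 - t) ^ (2 * n + 3)) *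
          ((1 + -(1 + t)⁻¹) ^ (2 * n + 1) * q.eval (-(1 + t)⁻¹)) := by ring
      _ = ((1 + -(1 + t)⁻¹) ^ (2 * n + 1) * (1 + t) ^ (2 * n + 1)) * ((1 + t) ^ (2 * n + 3) *
          q.eval (-(1 + t)⁻¹)) := by rw [h6]; ring
      _ = _ := by rw [h5]; ring
  have s1 := hsym 1 one_ne_zero (by norm_num)
  have s2 := hsym 2 two_ne_zero (by norm_num)
  rw [hqe, hqe] at s1 s2
  norm_num at s1 s2
  have hb : q.coeff 1 = q.coeff 0 := by
    have : (3 : K) * (q.coeff 1 - q.coeff 0) = 0 := by linear_combination s1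
    exact sub_eq_zero.1 ((mul_eq_zero.1 this).resolve_left (by norm_num))
  have ha : q.coeff 2 = q.coeff 0 := by
    have : (3 : K) * (q.coeff 2 - q.coeff 0) = 0 := by linear_combination s2 - 5 * hb
    exact sub_eq_zero.1 ((mul_eq_zero.1 this).resolve_left (by norm_num))
  refine ⟨q.coeff 0, ?_, fun t => ?_⟩
  · intro h
    apply hE0
    rw [evE, hEq, hqe, h]
    simp
  · rw [hEq, hqe, ha, hb]
    ring

theorem padeW_det_ne_zero {K : Type*} [Field K] [CharZero K] (n : ℕ) {x y z : K} (hx : x ≠ 0)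
    (hy : y ≠ 0) (hz : z ≠ 0) (h : x + y + z = 0) (he : x ^ 2 + x * y + y ^ 2 ≠ 0) :
    x ^ (2 * n + 1) * padeW n z (-y) * (y ^ (2 * (n + 1) + 1) * padeW (n + 1) x (-z)) ≠
      y ^ (2 * n + 1) * padeW n x (-z) * (x ^ (2 * (n + 1) + 1) * padeW (n + 1) z (-y)) := by
  obtain ⟨c, hc, hB⟩ := exists_padeB_eq (K := K) n
  have h1 : padeB n x y z ≠ 0 := by
    have e : padeB n x y z = y ^ (2 * n + 3) * padeB n (x / y) 1 (-1 - x / y) := by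
      rw [← padeB_mul]
      congr 1
      · field_simp
      · ring
      · field_simp
        linear_combination h
    rw [e, hB]
    have e1 : 1 + x / y = -z / y := by
      field_simp
      linear_combination h
    have e2 : (x / y) ^ 2 + x / y + 1 = (x ^ 2 + x * y + y ^ 2) / y ^ 2 := by
      field_simp
    rw [e1, e2]
    exact mul_ne_zero (pow_ne_zero _ hy) (mul_ne_zero (pow_ne_zero _ (div_ne_zero (neg_ne_zero.2 hz) hy))
      (mul_ne_zero hc (div_ne_zero he (pow_ne_zero _ hy))))
  intro h2
  apply mul_ne_zero (mul_ne_zero (pow_ne_zero (2 * n + 1) hx) (pow_ne_zero (2 * n + 1) hy)) h1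
  unfold padeB
  linear_combination h2

open MeasureTheory Metric in
theorem card_le_of_separated_of_norm_le_one {E : Type*} [NormedAddCommGroup E] [NormedSpace ℝ E]
    [FiniteDimensional ℝ E] {N : ℕ} (hN : 0 < N) (s : Finset E) (hs : ∀ c ∈ s, ‖c‖ ≤ 1)
    (h : ∀ c ∈ s, ∀ d ∈ s, c ≠ d → (1 : ℝ) / N ≤ ‖c - d‖) :
    s.card ≤ (2 * N + 1) ^ Module.finrank ℝ E := by
  borelize E
  let μ : Measure E := Measure.addHaar
  have hN' : (0 : ℝ) < N := by exact_mod_cast hN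
  let δ : ℝ := (1 : ℝ) / (2 * N)
  let ρ : ℝ := (2 * N + 1) * δ
  have δpos : 0 < δ := by positivity
  have ρpos : 0 < ρ := by positivity
  set A := ⋃ c ∈ s, ball (c : E) δ with hA
  have D : Set.Pairwise (s : Set E) (Function.onFun Disjoint fun c => ball (c : E) δ) := by
    rintro c hc d hd hcd
    apply ball_disjoint_ball
    rw [dist_eq_norm]
    refine le_trans (le_of_eq ?_) (h c hc d hd hcd)
    simp only [δ]
    field_simp
    norm_num
  have A_subset : A ⊆ ball (0 : E) ρ := by
    refine Set.iUnion₂_subset fun x hx => ?_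
    apply ball_subset_ball'
    calc
      δ + dist x 0 ≤ δ + 1 := by rw [dist_zero_right]; exact add_le_add le_rfl (hs x hx)
      _ = ρ := by simp only [ρ, δ]; field_simp; ring
  have I : (s.card : ENNReal) * ENNReal.ofReal (δ ^ Module.finrank ℝ E) * μ (ball 0 1) ≤
      ENNReal.ofReal (ρ ^ Module.finrank ℝ E) * μ (ball 0 1) :=
    calc
      (s.card : ENNReal) * ENNReal.ofReal (δ ^ Module.finrank ℝ E) * μ (ball 0 1) = μ A := by
        rw [hA, measure_biUnion_finset D fun c _ => measurableSet_ball]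
        simp only [μ.addHaar_ball_of_pos _ δpos]
        simp only [Finset.sum_const, nsmul_eq_mul, mul_assoc]
      _ ≤ μ (ball (0 : E) ρ) := measure_mono A_subset
      _ = ENNReal.ofReal (ρ ^ Module.finrank ℝ E) * μ (ball 0 1) := by
        simp only [μ.addHaar_ball_of_pos _ ρpos]
  have J : (s.card : ENNReal) * ENNReal.ofReal (δ ^ Module.finrank ℝ E) ≤
      ENNReal.ofReal (ρ ^ Module.finrank ℝ E) :=
    (ENNReal.mul_le_mul_iff_left (measure_ball_pos _ _ zero_lt_one).ne' measure_ball_lt_top.ne).1 I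
  have K : (s.card : ℝ) * δ ^ Module.finrank ℝ E ≤
      ((2 * N + 1 : ℝ) ^ Module.finrank ℝ E) * δ ^ Module.finrank ℝ E := by
    have := ENNReal.toReal_le_of_le_ofReal (pow_nonneg ρpos.le _) J
    rw [ENNReal.toReal_mul, ENNReal.toReal_ofReal (by positivity)] at this
    simpa [ρ, mul_pow] using this
  have := le_of_mul_le_mul_right K (by positivity)
  exact_mod_cast this

theorem Seminorm.card_le_of_separated {E : Type*} [AddCommGroup E] [Module ℝ E]
    [FiniteDimensional ℝ E] (p : Seminorm ℝ E) {N : ℕ} (hN : 0 < N) (s : Finset E)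
    (hs : ∀ c ∈ s, p c ≤ 1) (h : ∀ c ∈ s, ∀ d ∈ s, c ≠ d → (1 : ℝ) / N ≤ p (c - d)) :
    s.card ≤ (2 * N + 1) ^ Module.finrank ℝ E := by
  let := AddGroupSeminorm.toSeminormedAddCommGroup p.toAddGroupSeminorm
  let : NormedSpace ℝ E := ⟨fun a b => (map_smul_eq_mul p a b).le⟩
  have hp : ∀ x : E, ‖x‖ = p x := fun x => rfl
  have hsurj : Function.Surjective (SeparationQuotient.mkCLM ℝ E).toLinearMap :=
    Quotient.mk_surjective
  have hpos : (0 : ℝ) < 1 / N := by positivity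
  have hinj : Set.InjOn (SeparationQuotient.mk : E → SeparationQuotient E) s := by
    intro c hc d hd hcd
    by_contra hne
    have h1 := h c hc d hd hne
    have h2 : ‖SeparationQuotient.mk (c - d)‖ = 0 := by
      rw [SeparationQuotient.mk_sub, hcd, sub_self, norm_zero]
    rw [SeparationQuotient.norm_mk, hp] at h2
    linarith
  rw [← Finset.card_image_of_injOn hinj]
  refine (card_le_of_separated_of_norm_le_one hN _ ?_ ?_).trans
    (Nat.pow_le_pow_right (by omega) (LinearMap.finrank_le_finrank_of_surjective hsurj))
  · intro c hc
    obtain ⟨x, hx, rfl⟩ := Finset.mem_image.1 hc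
    exact hs x hx
  · intro c hc d hd hcd
    obtain ⟨x, hx, rfl⟩ := Finset.mem_image.1 hc
    obtain ⟨y, hy, rfl⟩ := Finset.mem_image.1 hd
    rw [← SeparationQuotient.mk_sub, SeparationQuotient.norm_mk]
    exact h x hx y hy fun h => hcd (by rw [h])

theorem Seminorm.exists_cover {E : Type*} [AddCommGroup E] [Module ℝ E]
    [FiniteDimensional ℝ E] (p : Seminorm ℝ E) {N : ℕ} (hN : 0 < N) (s : Finset E)
    (hs : ∀ c ∈ s, p c ≤ 1) :
    ∃ t : Finset E, t.card ≤ (2 * N + 1) ^ Module.finrank ℝ E ∧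
      ∀ c ∈ s, ∃ d ∈ t, p (c - d) < (1 : ℝ) / N := by
  have hpos : (0 : ℝ) < 1 / N := by positivity
  let P : Finset E → Prop := fun t => t ⊆ s ∧ ∀ c ∈ t, ∀ d ∈ t, c ≠ d → (1 : ℝ) / N ≤ p (c - d)
  obtain ⟨t, ht, hmax⟩ := (s.powerset.filter P).exists_max_image Finset.card
    ⟨∅, by simp [P]⟩
  simp only [Finset.mem_filter, Finset.mem_powerset, P] at ht hmax
  refine ⟨t, p.card_le_of_separated hN t (fun c hc => hs c (ht.1 hc)) ht.2.2, fun c hc => ?_⟩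
  by_contra! hcon
  have hct : c ∉ t := by
    intro hct
    have := hcon c hct
    rw [sub_self, map_zero] at this
    linarith
  have h1 : insert c t ⊆ s := Finset.insert_subset hc ht.1
  have h2 := hmax (insert c t) ⟨h1, h1, ?_⟩
  · rw [Finset.card_insert_of_notMem hct] at h2
    omega
  · intro x hx y hy hxy
    rcases Finset.mem_insert.1 hx with rfl | hx
    · rcases Finset.mem_insert.1 hy with rfl | hy
      · exact absurd rfl hxy
      · exact hcon y hy
    · rcases Finset.mem_insert.1 hy with rfl | hy
      · rw [map_sub_rev]
        exact hcon x ‹_›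
      · exact ht.2.2 x hx y hy hxy

theorem card_le_of_forall_ratio {ι : Type*} (T : Finset ι) (w : ι → ℝ) (hw : ∀ i ∈ T, 0 < w i)
    (h : ∀ i ∈ T, ∀ j ∈ T, i ≠ j → w i ≤ w j → 3 / 2 * w i ≤ w j ∧ w j < 25 * w i) :
    T.card ≤ 8 := by
  rcases T.eq_empty_or_nonempty with rfl | hne
  · simp
  obtain ⟨m, hm, hmin⟩ := T.exists_min_image w hne
  have hwm := hw m hm
  have hk : ∀ i ∈ T, ∃ k < 8, (3 / 2 : ℝ) ^ k ≤ w i / w m ∧ w i / w m < (3 / 2) ^ (k + 1) := by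
    intro i hi
    obtain ⟨k, h1, h2⟩ := exists_nat_pow_near ((one_le_div hwm).2 (hmin i hi))
      (by norm_num : (1 : ℝ) < 3 / 2)
    refine ⟨k, ?_, h1, h2⟩
    by_contra! hk
    have h3 : w i / w m < 25 := by
      by_cases him : m = i
      · rw [← him, div_self hwm.ne']
        norm_num
      · rw [div_lt_iff₀ hwm]
        exact (h m hm i hi him (hmin i hi)).2
    have h4 : (3 / 2 : ℝ) ^ 8 ≤ (3 / 2) ^ k := pow_le_pow_right₀ (by norm_num) hk
    norm_num at h4 h1
    linarith
  choose! k hk8 hk1 hk2 using hk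
  have hinj : Set.InjOn k T := by
    have aux : ∀ i ∈ T, ∀ j ∈ T, w i ≤ w j → k i = k j → i = j := by
      intro i hi j hj hij hkij
      by_contra hne
      have h1 := (h i hi j hj hne hij).1
      have h2 := hk2 j hj
      have h3 := hk1 i hi
      rw [← hkij, pow_succ, div_lt_iff₀ hwm] at h2
      rw [le_div_iff₀ hwm] at h3
      linarith
    intro i hi j hj hkij
    rcases le_total (w i) (w j) with hij | hij
    · exact aux i hi j hj hij hkij
    · exact (aux j hj i hi hij hkij.symm).symm
  calc T.card ≤ (Finset.range 8).card :=
        Finset.card_le_card_of_injOn k (fun i hi => Finset.mem_coe.2 (Finset.mem_range.2 (hk8 i hi))) hinj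
    _ = 8 := by simp

/-- Counting points in a cone decomposition, given a gap principle and a family of stronger
repulsion inequalities. -/
theorem card_le_of_repulsion {ι E : Type*} [AddCommGroup E] [Module ℝ E] [FiniteDimensional ℝ E]
    (p : Seminorm ℝ E) (h : E → ℝ) (hp : ∀ e, h e ≤ p e) (T : Finset ι) (a : ι → E)
    (h6 : ∀ i ∈ T, 6 ≤ h (a i)) (hpa : ∀ i ∈ T, p (a i) ≤ 2 * h (a i))
    (gap : ∀ i ∈ T, ∀ j ∈ T, i ≠ j → ∀ (c : ℝ) (e : E), a j = c • a i + e → 1 ≤ c → c ≤ 2 →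
      (2 - c) * h (a i) ≤ Real.log 2 + h e)
    (pade : ∀ i ∈ T, ∀ j ∈ T, i ≠ j → ∀ (n : ℕ) (c : ℝ) (e : E), a j = c • a i + e →
      2 * n + 3 ≤ c → c ≤ 3 * n + 2 →
      (3 * n + 2 - c) * h (a i) ≤ Real.log 2 + (n + 1) * Real.log 16 + h e) :
    T.card ≤ 8 * 101 ^ Module.finrank ℝ E := by
  have hlog2 : Real.log 2 ≤ 0.7 := by linarith [Real.log_two_lt_d9]
  have hlog16 : Real.log 16 ≤ 2.7727 := by
    rw [show (16 : ℝ) = 2 ^ (4 : ℕ) by norm_num, Real.log_pow]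
    push_cast
    linarith [Real.log_two_lt_d9]
  have hpos : ∀ i ∈ T, 0 < p (a i) := fun i hi => by linarith [h6 i hi, hp (a i)]
  let b : ι → E := fun i => (p (a i))⁻¹ • a i
  obtain ⟨t, htc, ht⟩ := p.exists_cover (N := 50) (by norm_num) (T.image b) (by
    intro c hc
    obtain ⟨i, hi, rfl⟩ := Finset.mem_image.1 hc
    have := hpos i hi
    simp only [b]
    rw [map_smul_eq_mul, norm_inv, Real.norm_of_nonneg this.le, inv_mul_cancel₀ this.ne'])
  have ht' : ∀ i ∈ T, ∃ d ∈ t, p (b i - d) < 1 / 50 := by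
    intro i hi
    obtain ⟨d, hd, h1⟩ := ht (b i) (Finset.mem_image_of_mem _ hi)
    exact ⟨d, hd, by simpa using h1⟩
  choose! f hft hf using ht'
  have hcell : ∀ d ∈ t, (T.filter fun i => f i = d).card ≤ 8 := by
    intro d hd
    refine card_le_of_forall_ratio _ (fun i => p (a i)) (fun i hi => hpos i (Finset.mem_filter.1 hi).1) ?_
    intro i hi j hj hij hle
    obtain ⟨hi, hfi⟩ := Finset.mem_filter.1 hi
    obtain ⟨hj, hfj⟩ := Finset.mem_filter.1 hj
    have hpi := hpos i hi
    have hpj := hpos j hj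
    have h6i := h6 i hi
    obtain ⟨c, hc⟩ : ∃ c : ℝ, c = p (a j) / p (a i) := ⟨_, rfl⟩
    have hcj : p (a j) = c * p (a i) := by rw [hc]; field_simp
    have hc1 : 1 ≤ c := by rw [hc]; exact (one_le_div hpi).2 hle
    have hbb : p (b j - b i) ≤ 1 / 25 := by
      have h1 := hf i hi
      have h2 := hf j hj
      rw [hfi] at h1
      rw [hfj] at h2
      have h3 : b j - b i = (b j - d) - (b i - d) := by abel
      rw [h3]
      have := map_sub_le_add p (b j - d) (b i - d)
      linarith
    obtain ⟨e, he⟩ : ∃ e : E, e = a j - c • a i := ⟨_, rfl⟩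
    have hae : a j = c • a i + e := by rw [he]; abel
    have he' : e = p (a j) • (b j - b i) := by
      rw [he, smul_sub]
      simp only [b]
      rw [smul_smul, smul_smul, mul_inv_cancel₀ hpj.ne', one_smul, hc, div_eq_mul_inv]
    have hhe : h e ≤ 0.08 * c * h (a i) := by
      have h1 := hp e
      have h2 : p e = p (a j) * p (b j - b i) := by
        rw [he', map_smul_eq_mul, Real.norm_of_nonneg hpj.le]
      have h3 : p (a j) * p (b j - b i) ≤ p (a j) * (1 / 25) :=
        mul_le_mul_of_nonneg_left hbb hpj.le
      have h4 : c * p (a i) ≤ c * (2 * h (a i)) :=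
        mul_le_mul_of_nonneg_left (hpa i hi) (by linarith)
      linarith
    have hgap : 3 / 2 ≤ c := by
      by_contra! hlt
      have h1 := gap i hi j hj hij c e hae hc1 (by linarith)
      nlinarith
    refine ⟨by rw [hcj]; exact mul_le_mul_of_nonneg_right hgap hpi.le, ?_⟩
    rw [hcj]
    refine mul_lt_mul_of_pos_right ?_ hpi
    by_contra! h25
    obtain ⟨n, hn⟩ : ∃ n : ℕ, n = ⌊(c - 3) / 2⌋₊ := ⟨_, rfl⟩
    have hn1 : (n : ℝ) ≤ (c - 3) / 2 := by
      rw [hn]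
      exact Nat.floor_le (by linarith)
    have hn2 : (c - 3) / 2 < n + 1 := by
      rw [hn]
      exact Nat.lt_floor_add_one _
    have hn11 : 11 ≤ n := by
      rw [hn]
      apply Nat.le_floor
      push_cast
      linarith
    have hn11' : (11 : ℝ) ≤ n := by exact_mod_cast hn11
    have h1 := pade i hi j hj hij n c e hae (by linarith) (by linarith)
    have h2 : (n + 1 : ℝ) * Real.log 16 ≤ (n + 1) * 2.7727 :=
      mul_le_mul_of_nonneg_left hlog16 (by linarith)
    have h3 : (3 * n + 2 - 1.08 * c) * h (a i) ≤ 0.7 + (n + 1) * 2.7727 := by linarith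
    have h4 : (3 * n + 2 - 1.08 * (2 * n + 5)) * 6 ≤ (3 * n + 2 - 1.08 * c) * h (a i) :=
      mul_le_mul (by linarith) h6i (by norm_num) (by linarith)
    linarith
  calc T.card ≤ 8 * t.card :=
        Finset.card_le_mul_card_image_of_maps_to (fun i hi => hft i hi) 8 hcell
    _ ≤ 8 * 101 ^ Module.finrank ℝ E := Nat.mul_le_mul_left _ htc

/-- An archimedean absolute value and a `p`-adic absolute value for each `p ∈ S` on a field `L`,
normalised on the integers. -/
structure PlaceFamily (L : Type*) [Field L] (S : Finset ℕ) where
  val : Option S → AbsoluteValue L ℝ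
  nonarch : ∀ p, IsNonarchimedean (val (some p))
  val_none_int : ∀ N : ℤ, val none (N : L) = |(N : ℝ)|
  val_some_int : ∀ (p : S) (N : ℤ), val (some p) (N : L) = padicNorm (p : ℕ) (N : ℚ)

theorem nonempty_placeFamily (L : Type*) [Field L] [Algebra ℚ L] [Algebra.IsAlgebraic ℚ L]
    {S : Finset ℕ} (hS : ∀ p ∈ S, p.Prime) : Nonempty (PlaceFamily L S) := by
  have h : ∀ p : S, ∃ v : AbsoluteValue L ℝ, IsNonarchimedean v ∧
      ∀ N : ℤ, v (N : L) = padicNorm (p : ℕ) (N : ℚ) := by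
    intro p
    have : Fact (p : ℕ).Prime := ⟨hS p p.2⟩
    let f : L →ₐ[ℚ] PadicAlgCl (p : ℕ) := IsAlgClosed.lift
    refine ⟨(IsAbsoluteValue.toAbsoluteValue (norm : PadicAlgCl (p : ℕ) → ℝ)).comp
      (f := f.toRingHom) f.injective, ?_, ?_⟩
    · intro x y
      show ‖f (x + y)‖ ≤ max ‖f x‖ ‖f y‖
      rw [map_add]
      exact PadicAlgCl.isNonarchimedean p _ _
    · intro N
      show ‖f N‖ = _
      rw [map_intCast]
      have h1 := PadicAlgCl.norm_extends p (N : ℚ_[p])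
      rw [map_intCast] at h1
      rw [h1]
      have := Padic.eq_padicNorm (p := p) (N : ℚ)
      simpa using this
  choose v hv1 hv2 using h
  let f : L →ₐ[ℚ] ℂ := IsAlgClosed.lift
  refine ⟨⟨fun o => o.elim ((IsAbsoluteValue.toAbsoluteValue (norm : ℂ → ℝ)).comp
      (f := f.toRingHom) f.injective) v, hv1, ?_, hv2⟩⟩
  intro N
  show ‖f N‖ = _
  rw [map_intCast, Complex.norm_intCast]

/-- The indicator of the archimedean place. -/
def archWeight {S : Finset ℕ} (o : Option S) : ℝ := o.elim 1 fun _ => 0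

theorem sum_archWeight (S : Finset ℕ) : ∑ o : Option S, archWeight o = 1 := by
  rw [Fintype.sum_option]
  simp [archWeight]

namespace PlaceFamily

variable {L : Type*} [Field L] {S : Finset ℕ} (P : PlaceFamily L S)

theorem log_val_some_int (hS : ∀ p ∈ S, p.Prime) (p : S) {N : ℤ} (hN : N ≠ 0) :
    Real.log (P.val (some p) (N : L)) = -(N.natAbs.factorization p * Real.log (p : ℕ)) := by
  have : Fact (p : ℕ).Prime := ⟨hS p p.2⟩
  rw [P.val_some_int, padicNorm.eq_zpow_of_nonzero (Int.cast_ne_zero.2 hN), padicValRat.of_int]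
  push_cast
  rw [Real.log_zpow, Nat.factorization_def _ (hS p p.2)]
  simp [padicValInt]

theorem log_val_none_int {N : ℤ} :
    Real.log (P.val none (N : L)) = N.natAbs.factorization.sum fun p t => t * Real.log p := by
  rw [P.val_none_int, ← Real.log_nat_eq_sum_factorization, Nat.cast_natAbs]
  push_cast
  rfl

theorem sum_log_int_nonneg (hS : ∀ p ∈ S, p.Prime) {N : ℤ} (hN : N ≠ 0) :
    0 ≤ ∑ o, Real.log (P.val o (N : L)) := by
  rw [Fintype.sum_option, P.log_val_none_int, Finset.sum_congr rfl fun p _ =>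
    P.log_val_some_int hS p hN, Finset.sum_neg_distrib,
    Finset.sum_coe_sort S fun p => N.natAbs.factorization p * Real.log p, ← sub_eq_add_neg, sub_nonneg]
  unfold Finsupp.sum
  have hlog : ∀ p : ℕ, 0 ≤ N.natAbs.factorization p * Real.log p := fun p =>
    mul_nonneg (Nat.cast_nonneg _) (Real.log_natCast_nonneg _)
  refine (Finset.sum_le_sum_of_subset_of_nonneg (t := N.natAbs.factorization.support ∪ S)
    Finset.subset_union_right fun p _ _ => hlog p).trans (le_of_eq ?_)
  refine (Finset.sum_subset Finset.subset_union_left fun p _ hp => ?_).symm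
  rw [Finsupp.notMem_support_iff.1 hp]
  simp

theorem sum_log_int_eq_zero (hS : ∀ p ∈ S, p.Prime) {N : ℤ} (hN : N ≠ 0)
    (h : N.natAbs.primeFactors ⊆ S) :
    ∑ o, Real.log (P.val o (N : L)) = 0 := by
  rw [Fintype.sum_option, P.log_val_none_int, Finset.sum_congr rfl fun p _ =>
    P.log_val_some_int hS p hN, Finset.sum_neg_distrib,
    Finset.sum_coe_sort S fun p => N.natAbs.factorization p * Real.log p, ← sub_eq_add_neg, sub_eq_zero]
  unfold Finsupp.sum
  refine Finset.sum_subset h fun p _ hp => ?_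
  rw [Finsupp.notMem_support_iff.1 hp]
  simp

theorem val_sum_le {ι : Type*} (o : Option S) (s : Finset ι) (c : ι → ℕ) (x : ι → L) {C : ℕ} {M : ℝ}
    (hC : ∑ i ∈ s, c i ≤ C) (hC1 : 1 ≤ C) (hM : 0 ≤ M) (hx : ∀ i ∈ s, P.val o (x i) ≤ M) :
    P.val o (∑ i ∈ s, (c i : L) * x i) ≤ Real.exp (archWeight o * Real.log C) * M := by
  rcases o with _ | p
  · have h1 : Real.exp (archWeight (none : Option S) * Real.log C) = C := by
      simp only [archWeight, Option.elim, one_mul]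
      exact Real.exp_log (by exact_mod_cast hC1)
    rw [h1]
    calc P.val none (∑ i ∈ s, (c i : L) * x i) ≤ ∑ i ∈ s, P.val none ((c i : L) * x i) :=
          (P.val none).sum_le _ _
      _ ≤ ∑ i ∈ s, (c i : ℝ) * M := by
          refine Finset.sum_le_sum fun i hi => ?_
          rw [map_mul]
          have := P.val_none_int (c i)
          rw [Int.cast_natCast, Int.cast_natCast, Nat.abs_cast] at this
          rw [this]
          exact mul_le_mul_of_nonneg_left (hx i hi) (Nat.cast_nonneg _)
      _ = ((∑ i ∈ s, c i : ℕ) : ℝ) * M := by rw [Nat.cast_sum, Finset.sum_mul]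
      _ ≤ C * M := mul_le_mul_of_nonneg_right (by exact_mod_cast hC) hM
  · have h1 : Real.exp (archWeight (some p : Option S) * Real.log C) = 1 := by
      simp [archWeight]
    rw [h1, one_mul]
    rcases s.eq_empty_or_nonempty with rfl | hs
    · simpa using hM
    refine (IsNonarchimedean.apply_sum_le_sup (P.nonarch p) hs).trans (Finset.sup'_le hs _ fun i hi => ?_)
    rw [map_mul]
    have h2 : P.val (some p) (c i : L) ≤ 1 := by
      exact IsNonarchimedean.apply_natCast_le_one (P.nonarch p)
    calc P.val (some p) (c i : L) * P.val (some p) (x i) ≤ 1 * M :=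
          mul_le_mul h2 (hx i hi) ((P.val _).nonneg _) zero_le_one
      _ = M := one_mul M

theorem val_add_le (o : Option S) {x y : L} {B : ℝ} (hx : P.val o x ≤ Real.exp B)
    (hy : P.val o y ≤ Real.exp B) :
    P.val o (x + y) ≤ Real.exp (archWeight o * Real.log 2 + B) := by
  have h := P.val_sum_le o Finset.univ (fun _ : Fin 2 => 1) ![x, y] (C := 2) (by simp)
    (by norm_num) (Real.exp_pos B).le (by simp [Fin.forall_fin_two, hx, hy])
  rw [Real.exp_add]
  simpa [Fin.sum_univ_two] using h

end PlaceFamily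

theorem exists_int_prod_eq {L : Type*} [Field L] [Algebra ℚ L] [IsGalois ℚ L] {ι : Type*} [Fintype ι]
    (d : ι → L) (hd : ∀ i, IsIntegral ℤ (d i))
    (h : ∀ g : L ≃ₐ[ℚ] L, ∃ π : Equiv.Perm ι, ∀ i, g (d i) = d (π i)) :
    ∃ N : ℤ, (N : L) = ∏ i, d i := by
  have h1 : (∏ i, d i) ∈ Set.range (algebraMap ℚ L) := by
    rw [InfiniteGalois.mem_range_algebraMap_iff_fixed]
    intro g
    obtain ⟨π, hπ⟩ := h g
    rw [map_prod, Finset.prod_congr rfl fun i _ => hπ i]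
    exact Equiv.prod_comp π d
  obtain ⟨q, hq⟩ := h1
  have h2 : IsIntegral ℤ (∏ i, d i) := IsIntegral.prod _ fun i _ => hd i
  rw [← hq] at h2
  have h3 : IsIntegral ℤ q := (isIntegral_algebraMap_iff (algebraMap ℚ L).injective).1 h2
  obtain ⟨N, hN⟩ := IsIntegrallyClosed.isIntegral_iff.1 h3
  refine ⟨N, ?_⟩
  rw [← hq, ← hN]
  simp

section SignedDifferences

variable {L : Type*} [Field L]

/-- The three differences of a signed triple. -/
def diffVec (z : Fin 3 → L) (σ : Fin 3 → ℤˣ) (i : Fin 3) : L :=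
  ((σ (i + 1) : ℤ) : L) * z (i + 1) - ((σ (i + 2) : ℤ) : L) * z (i + 2)

/-- The three sums of a signed triple. -/
def sumVec (z : Fin 3 → L) (σ : Fin 3 → ℤˣ) (i : Fin 3) : L :=
  ((σ (i + 1) : ℤ) : L) * z (i + 1) + ((σ (i + 2) : ℤ) : L) * z (i + 2)

/-- A triple whose squares are integers with differences `β`. -/
def IsSqTriple (β : Fin 3 → ℤ) (z : Fin 3 → L) : Prop :=
  ∃ w : Fin 3 → ℤ, (∀ i, z i ^ 2 = w i) ∧ ∀ i, w (i + 1) - w (i + 2) = β i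

theorem cast_units_sq (u : ℤˣ) : ((u : ℤ) : L) ^ 2 = 1 := by
  rcases Int.units_eq_one_or u with rfl | rfl <;> simp

theorem sum_diffVec (z : Fin 3 → L) (σ : Fin 3 → ℤˣ) :
    diffVec z σ 0 + diffVec z σ 1 + diffVec z σ 2 = 0 := by
  simp only [diffVec, zero_add, show (1 : Fin 3) + 1 = 2 from rfl, show (1 : Fin 3) + 2 = 0 from rfl,
    show (2 : Fin 3) + 1 = 0 from rfl, show (2 : Fin 3) + 2 = 1 from rfl]
  ring

variable {β : Fin 3 → ℤ} {z : Fin 3 → L}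

theorem IsSqTriple.diffVec_mul_sumVec (h : IsSqTriple β z) (σ : Fin 3 → ℤˣ) (i : Fin 3) :
    diffVec z σ i * sumVec z σ i = β i := by
  obtain ⟨w, h1, h2⟩ := h
  rw [← h2]
  push_cast
  rw [← h1, ← h1]
  unfold diffVec sumVec
  linear_combination (z (i + 1)) ^ 2 * cast_units_sq (L := L) (σ (i + 1)) -
    (z (i + 2)) ^ 2 * cast_units_sq (L := L) (σ (i + 2))

theorem IsSqTriple.isIntegral (h : IsSqTriple β z) (i : Fin 3) : IsIntegral ℤ (z i) := by
  obtain ⟨w, h1, -⟩ := h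
  refine IsIntegral.of_pow (n := 2) (by norm_num) ?_
  rw [h1]
  exact isIntegral_algebraMap (R := ℤ) (A := L) (x := w i)

theorem isIntegral_intCast' (n : ℤ) : IsIntegral ℤ (n : L) :=
  isIntegral_algebraMap (R := ℤ) (A := L) (x := n)

theorem IsSqTriple.isIntegral_diffVec (h : IsSqTriple β z) (σ : Fin 3 → ℤˣ) (i : Fin 3) :
    IsIntegral ℤ (diffVec z σ i) :=
  ((isIntegral_intCast' _).mul (h.isIntegral _)).sub ((isIntegral_intCast' _).mul (h.isIntegral _))

theorem IsSqTriple.isIntegral_sumVec (h : IsSqTriple β z) (σ : Fin 3 → ℤˣ) (i : Fin 3) :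
    IsIntegral ℤ (sumVec z σ i) :=
  ((isIntegral_intCast' _).mul (h.isIntegral _)).add ((isIntegral_intCast' _).mul (h.isIntegral _))

variable [CharZero L]

theorem IsSqTriple.diffVec_ne_zero (h : IsSqTriple β z) (hβ : ∀ i, β i ≠ 0) (σ : Fin 3 → ℤˣ)
    (i : Fin 3) : diffVec z σ i ≠ 0 := by
  have h1 := h.diffVec_mul_sumVec σ i
  intro h0
  rw [h0, zero_mul] at h1
  exact hβ i (by exact_mod_cast h1.symm)

theorem IsSqTriple.sumVec_ne_zero (h : IsSqTriple β z) (hβ : ∀ i, β i ≠ 0) (σ : Fin 3 → ℤˣ)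
    (i : Fin 3) : sumVec z σ i ≠ 0 := by
  have h1 := h.diffVec_mul_sumVec σ i
  intro h0
  rw [h0, mul_zero] at h1
  exact hβ i (by exact_mod_cast h1.symm)

theorem sq_ne_of_pairwise_ne {A B C : ℤ} (hAB : A ≠ B) (hBC : B ≠ C) (hCA : C ≠ A) :
    (A ^ 2 + B ^ 2 + C ^ 2 + A * B + B * C + C * A) ^ 2 ≠ 12 * (A * B * C) * (A + B + C) := by
  intro h
  have h1 : ((A - B) * (A + B + 2 * C)) ^ 2 + ((B - C) * (B + C + 2 * A)) ^ 2 +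
      ((C - A) * (C + A + 2 * B)) ^ 2 = 0 := by linear_combination 2 * h
  have h2 : (A - B) * (A + B + 2 * C) = 0 := by
    refine pow_eq_zero_iff two_ne_zero |>.1 (le_antisymm ?_ (sq_nonneg _))
    nlinarith [sq_nonneg ((B - C) * (B + C + 2 * A)), sq_nonneg ((C - A) * (C + A + 2 * B))]
  have h3 : (C - A) * (C + A + 2 * B) = 0 := by
    refine pow_eq_zero_iff two_ne_zero |>.1 (le_antisymm ?_ (sq_nonneg _))
    nlinarith [sq_nonneg ((B - C) * (B + C + 2 * A)), sq_nonneg ((A - B) * (A + B + 2 * C))]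
  have h4 := (mul_eq_zero.1 h2).resolve_left (sub_ne_zero.2 hAB)
  have h5 := (mul_eq_zero.1 h3).resolve_left (sub_ne_zero.2 hCA)
  omega

/-- The differences of a triple with distinct integral squares never form an equilateral triangle. -/
theorem IsSqTriple.not_equilateral (h : IsSqTriple β z) (hβ : ∀ i, β i ≠ 0) (σ : Fin 3 → ℤˣ) :
    diffVec z σ 0 ^ 2 + diffVec z σ 0 * diffVec z σ 1 + diffVec z σ 1 ^ 2 ≠ 0 := by
  obtain ⟨w, h1, h2⟩ := h
  intro h0
  have b0 := hβ 0
  have b1 := hβ 1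
  have b2 := hβ 2
  rw [← h2] at b0 b1 b2
  simp only [diffVec, zero_add, show (1 : Fin 3) + 1 = 2 from rfl, show (1 : Fin 3) + 2 = 0 from rfl,
    show (2 : Fin 3) + 1 = 0 from rfl, show (2 : Fin 3) + 2 = 1 from rfl] at h0 b0 b1 b2
  obtain ⟨u, hu⟩ : ∃ u : Fin 3 → L, ∀ i, u i = ((σ i : ℤ) : L) * z i := ⟨_, fun i => rfl⟩
  rw [← hu, ← hu, ← hu] at h0
  have hw : ∀ i, (w i : L) = u i ^ 2 := by
    intro i
    rw [hu, mul_pow, cast_units_sq, one_mul, h1]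
  have h3 : ((w 0 ^ 2 + w 1 ^ 2 + w 2 ^ 2 + w 0 * w 1 + w 1 * w 2 + w 2 * w 0) ^ 2 : ℤ) =
      12 * (w 0 * w 1 * w 2) * (w 0 + w 1 + w 2) := by
    have : (((w 0 ^ 2 + w 1 ^ 2 + w 2 ^ 2 + w 0 * w 1 + w 1 * w 2 + w 2 * w 0) ^ 2 : ℤ) : L) =
        ((12 * (w 0 * w 1 * w 2) * (w 0 + w 1 + w 2) : ℤ) : L) := by
      push_cast
      simp only [hw]
      have h5 : u 0 * u 1 + u 1 * u 2 + u 2 * u 0 = u 0 ^ 2 + u 1 ^ 2 + u 2 ^ 2 := by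
        linear_combination -h0
      linear_combination (-(u 0 * u 1 + u 1 * u 2 + u 2 * u 0 + (u 0 ^ 2 + u 1 ^ 2 + u 2 ^ 2)) *
        (4 * (u 0 + u 1 + u 2) * (u 0 * u 1 * u 2) + (u 0 ^ 2 + u 1 ^ 2 + u 2 ^ 2 -
        (u 0 * u 1 + u 1 * u 2 + u 2 * u 0)) * (u 0 * u 1 + u 1 * u 2 + u 2 * u 0 +
        (u 0 ^ 2 + u 1 ^ 2 + u 2 ^ 2))) + 8 * (u 0 * u 1 * u 2) ^ 2) * h5
    exact_mod_cast this
  exact sq_ne_of_pairwise_ne (by omega) (by omega) (by omega) h3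

end SignedDifferences

/-- The maximum of three real numbers. -/
def max3 (f : Fin 3 → ℝ) : ℝ := max (f 0) (max (f 1) (f 2))

theorem le_max3 (f : Fin 3 → ℝ) (i : Fin 3) : f i ≤ max3 f := by
  unfold max3
  fin_cases i <;> simp

theorem max3_le {f : Fin 3 → ℝ} {b : ℝ} (h : ∀ i, f i ≤ b) : max3 f ≤ b :=
  max_le (h 0) (max_le (h 1) (h 2))

theorem exists_eq_max3 (f : Fin 3 → ℝ) : ∃ i, f i = max3 f := by
  unfold max3
  rcases max_choice (f 0) (max (f 1) (f 2)) with h | h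
  · exact ⟨0, h.symm⟩
  · rcases max_choice (f 1) (f 2) with h' | h'
    · exact ⟨1, by rw [h, h']⟩
    · exact ⟨2, by rw [h, h']⟩

theorem max3_add_le (f g : Fin 3 → ℝ) : max3 (fun i => f i + g i) ≤ max3 f + max3 g :=
  max3_le fun i => add_le_add (le_max3 f i) (le_max3 g i)

theorem max3_mul {c : ℝ} (hc : 0 ≤ c) (f : Fin 3 → ℝ) : max3 (fun i => c * f i) = c * max3 f := by
  refine le_antisymm (max3_le fun i => mul_le_mul_of_nonneg_left (le_max3 f i) hc) ?_
  obtain ⟨i, hi⟩ := exists_eq_max3 f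
  rw [← hi]
  exact le_max3 (fun i => c * f i) i

theorem sum_three_eq (f : Fin 3 → ℝ) (i : Fin 3) : f 0 + f 1 + f 2 = f i + f (i + 1) + f (i + 2) := by
  fin_cases i
  · rfl
  · show _ = f 1 + f 2 + f 0
    ring
  · show _ = f 2 + f 0 + f 1
    ring

section PadeDelta

variable {L : Type*} [Field L]

/-- The three terms of the Padé relation of a triple with sum zero. -/
def padeT (n : ℕ) (x : Fin 3 → L) (i : Fin 3) : L :=
  x i ^ (2 * n + 1) * padeW n (x (i + 2)) (-x (i + 1))

/-- The determinant of a triple and the Padé relation of another one. -/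
def padeDelta (n : ℕ) (x x' : Fin 3 → L) : L := x' 1 * padeT n x 2 - x' 2 * padeT n x 1

theorem sum_padeT (n : ℕ) {x : Fin 3 → L} (hx : ∀ i, x i ≠ 0) (h : x 0 + x 1 + x 2 = 0) :
    padeT n x 0 + padeT n x 1 + padeT n x 2 = 0 :=
  padeW_identity n (hx 0) (hx 1) (hx 2) h

theorem padeDelta_eq (n : ℕ) {x x' : Fin 3 → L} (hx : ∀ i, x i ≠ 0) (h : x 0 + x 1 + x 2 = 0)
    (h' : x' 0 + x' 1 + x' 2 = 0) (i : Fin 3) :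
    padeDelta n x x' = x' (i + 1) * padeT n x (i + 2) - x' (i + 2) * padeT n x (i + 1) := by
  have h1 := sum_padeT n hx h
  unfold padeDelta
  fin_cases i
  · rfl
  · show _ = x' 2 * padeT n x 0 - x' 0 * padeT n x 2
    linear_combination padeT n x 2 * h' - x' 2 * h1
  · show _ = x' 0 * padeT n x 1 - x' 1 * padeT n x 0
    linear_combination x' 1 * h1 - padeT n x 1 * h'

theorem padeDelta_ne_zero_or [CharZero L] (n : ℕ) {x x' : Fin 3 → L} (hx : ∀ i, x i ≠ 0)
    (h : x 0 + x 1 + x 2 = 0) (hx' : ∀ i, x' i ≠ 0) (h' : x' 0 + x' 1 + x' 2 = 0)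
    (he : x 0 ^ 2 + x 0 * x 1 + x 1 ^ 2 ≠ 0) :
    padeDelta n x x' ≠ 0 ∨ padeDelta (n + 1) x x' ≠ 0 := by
  by_contra! hcon
  obtain ⟨h1, h2⟩ := hcon
  rw [padeDelta_eq _ hx h h' 2] at h1 h2
  change x' 0 * padeT _ x 1 - x' 1 * padeT _ x 0 = 0 at h1
  change x' 0 * padeT _ x 1 - x' 1 * padeT _ x 0 = 0 at h2
  have h3 := padeW_det_ne_zero n (hx 0) (hx 1) (hx 2) h he
  change padeT n x 0 * padeT (n + 1) x 1 ≠ padeT n x 1 * padeT (n + 1) x 0 at h3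
  apply h3
  apply mul_left_cancel₀ (hx' 0)
  linear_combination padeT n x 0 * h2 - padeT (n + 1) x 0 * h1

variable {S : Finset ℕ} (P : PlaceFamily L S)

theorem PlaceFamily.val_padeW_le (o : Option S) (n : ℕ) {y z : L} {M : ℝ}
    (hy : P.val o y ≤ Real.exp M) (hz : P.val o z ≤ Real.exp M) :
    P.val o (padeW n y z) ≤ Real.exp (archWeight o * (n * Real.log 16) + n * M) := by
  have h := P.val_sum_le o (Finset.HasAntidiagonal.antidiagonal n)
    (fun m => (n + m.1).choose n * (n + m.2).choose n) (fun m => y ^ m.1 * z ^ m.2)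
    (M := Real.exp (n * M)) (sum_choose_mul_choose_le n) (Nat.one_le_pow _ _ (by norm_num))
    (Real.exp_pos _).le (by
      intro m hm
      rw [map_mul, map_pow, map_pow, ← Finset.HasAntidiagonal.mem_antidiagonal.1 hm, Nat.cast_add,
        add_mul, Real.exp_add, Real.exp_nat_mul, Real.exp_nat_mul]
      have := (P.val o).nonneg y
      have := (P.val o).nonneg z
      gcongr)
  rw [← Real.exp_add] at h
  rw [Nat.cast_pow, Real.log_pow] at h
  refine le_trans (le_of_eq ?_) h
  unfold padeW
  congr 1
  exact Finset.sum_congr rfl fun m _ => by ring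

theorem PlaceFamily.val_padeDelta_le (o : Option S) (n : ℕ) {x x' : Fin 3 → L} (hx : ∀ i, x i ≠ 0)
    (h : x 0 + x 1 + x 2 = 0) (hx' : ∀ i, x' i ≠ 0) (h' : x' 0 + x' 1 + x' 2 = 0)
    {a e : Fin 3 → ℝ} {c q : ℝ} (ha : ∀ i, a i = Real.log (P.val o (x i)))
    (ha' : ∀ i, Real.log (P.val o (x' i)) = c * a i + e i) (hc : 2 * n + 1 ≤ c)
    (hq : q ≤ 3 * n + 2 - c) :
    P.val o (padeDelta n x x') ≤ Real.exp (archWeight o * (Real.log 2 + n * Real.log 16) +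
      ((3 * n + 1 + c + q) * ((a 0 + a 1 + a 2) / 3) - q * max3 a + max3 e)) := by
  have hv : ∀ i, P.val o (x i) = Real.exp (a i) := fun i => by
    rw [ha, Real.exp_log ((P.val o).pos (hx i))]
  have hv' : ∀ i, P.val o (x' i) = Real.exp (c * a i + e i) := fun i => by
    rw [← ha', Real.exp_log ((P.val o).pos (hx' i))]
  have hM : ∀ i, P.val o (x i) ≤ Real.exp (max3 a) := fun i => by
    rw [hv]
    exact Real.exp_le_exp.2 (le_max3 a i)
  have hT : ∀ i, P.val o (padeT n x i) ≤
      Real.exp ((2 * n + 1) * a i + (archWeight o * (n * Real.log 16) + n * max3 a)) := by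
    intro i
    unfold padeT
    rw [map_mul, map_pow, Real.exp_add]
    have e1 : P.val o (x i) ^ (2 * n + 1) = Real.exp ((2 * n + 1) * a i) := by
      rw [hv, ← Real.exp_nat_mul]
      push_cast
      rfl
    rw [e1]
    refine mul_le_mul_of_nonneg_left (P.val_padeW_le o n (hM _) ?_) (Real.exp_pos _).le
    rw [(P.val o).map_neg]
    exact hM _
  obtain ⟨k, hk⟩ := exists_eq_max3 a
  have hmean : a 0 + a 1 + a 2 ≤ 3 * max3 a := by
    linarith [le_max3 a 0, le_max3 a 1, le_max3 a 2]
  have hprod : ∀ i j, a i + a j + a k = a 0 + a 1 + a 2 → P.val o (x' i * padeT n x j) ≤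
      Real.exp (archWeight o * (n * Real.log 16) +
        ((3 * n + 1 + c + q) * ((a 0 + a 1 + a 2) / 3) - q * max3 a + max3 e)) := by
    intro i j hij
    rw [map_mul, hv']
    refine (mul_le_mul_of_nonneg_left (hT j) (Real.exp_pos _).le).trans ?_
    rw [← Real.exp_add]
    refine Real.exp_le_exp.2 ?_
    have h1 : (c - 2 * n - 1) * a i ≤ (c - 2 * n - 1) * max3 a :=
      mul_le_mul_of_nonneg_left (le_max3 a i) (by linarith)
    have h2 := le_max3 e i
    have h3 : (q - (3 * n + 2 - c)) * (max3 a - (a 0 + a 1 + a 2) / 3) ≤ 0 :=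
      mul_nonpos_of_nonpos_of_nonneg (by linarith) (by linarith)
    rw [hk] at hij
    have h4 : (2 * n + 1) * (a i + a j) = (2 * n + 1) * (a 0 + a 1 + a 2 - max3 a) := by
      rw [← hij]
      ring
    nlinarith
  rw [padeDelta_eq n hx h h' k, sub_eq_add_neg]
  have h1 := hprod (k + 1) (k + 2) (by rw [sum_three_eq a k]; ring)
  have h2 := hprod (k + 2) (k + 1) (by rw [sum_three_eq a k]; ring)
  rw [← (P.val o).map_neg] at h2
  refine (P.val_add_le o h1 h2).trans (Real.exp_le_exp.2 ?_)
  linarith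

end PadeDelta

section Repulsion

variable {L : Type*} [Field L] {S : Finset ℕ} (P : PlaceFamily L S)

/-- The logarithms of the signed differences of a triple at all places. -/
def logVec (z : Fin 3 → L) (o : Option S) (σ : Fin 3 → ℤˣ) (i : Fin 3) : ℝ :=
  Real.log (P.val o (diffVec z σ i))

/-- The sum of the local maxima, averaged over the signs. -/
def maxHeight (u : Option S → (Fin 3 → ℤˣ) → Fin 3 → ℝ) : ℝ := (∑ o, ∑ σ, max3 (u o σ)) / 8

theorem card_signs : Fintype.card (Fin 3 → ℤˣ) = 8 := by
  simp

theorem isIntegral_padeDelta (n : ℕ) {x x' : Fin 3 → L} (hx : ∀ i, IsIntegral ℤ (x i))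
    (hx' : ∀ i, IsIntegral ℤ (x' i)) : IsIntegral ℤ (padeDelta n x x') := by
  have hW : ∀ y z : L, IsIntegral ℤ y → IsIntegral ℤ z → IsIntegral ℤ (padeW n y z) := by
    intro y z hy hz
    refine IsIntegral.sum _ fun m _ => ((IsIntegral.mul ?_ (hy.pow _)).mul (hz.pow _))
    have := isIntegral_intCast' (L := L) ((n + m.1).choose n * (n + m.2).choose n : ℕ)
    rwa [Int.cast_natCast] at this
  have hT : ∀ i, IsIntegral ℤ (padeT n x i) := fun i => ((hx _).pow _).mul (hW _ _ (hx _) (hx _).neg)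
  exact ((hx' _).mul (hT _)).sub ((hx' _).mul (hT _))

variable [Algebra ℚ L]

/-- The Galois group acts on the entries of `z` through the signs `τ`. -/
def HasSigns (τ : (L ≃ₐ[ℚ] L) → Fin 3 → ℤˣ) (z : Fin 3 → L) : Prop :=
  ∀ g i, g (z i) = ((τ g i : ℤ) : L) * z i

variable {τ : (L ≃ₐ[ℚ] L) → Fin 3 → ℤˣ} {z z' : Fin 3 → L}

theorem HasSigns.map_diffVec (h : HasSigns τ z) (g : L ≃ₐ[ℚ] L) (σ : Fin 3 → ℤˣ) (i : Fin 3) :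
    g (diffVec z σ i) = diffVec z (τ g * σ) i := by
  simp only [diffVec, map_sub, map_mul, map_intCast, h g, Pi.mul_apply, Units.val_mul, Int.cast_mul]
  ring

theorem HasSigns.map_sumVec (h : HasSigns τ z) (g : L ≃ₐ[ℚ] L) (σ : Fin 3 → ℤˣ) (i : Fin 3) :
    g (sumVec z σ i) = sumVec z (τ g * σ) i := by
  simp only [sumVec, map_add, map_mul, map_intCast, h g, Pi.mul_apply, Units.val_mul, Int.cast_mul]
  ring

theorem HasSigns.map_padeDelta (h : HasSigns τ z) (h' : HasSigns τ z') (g : L ≃ₐ[ℚ] L)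
    (σ : Fin 3 → ℤˣ) (n : ℕ) :
    g (padeDelta n (diffVec z σ) (diffVec z' σ)) =
      padeDelta n (diffVec z (τ g * σ)) (diffVec z' (τ g * σ)) := by
  have hW : ∀ y z : L, g (padeW n y z) = padeW n (g y) (g z) := map_padeW (g : L →+* L) n
  simp only [padeDelta, padeT, map_sub, map_mul, map_pow, hW, map_neg, h.map_diffVec, h'.map_diffVec]

variable [IsGalois ℚ L]

theorem PlaceFamily.sum_log_nonneg (hS : ∀ p ∈ S, p.Prime) (τ : (L ≃ₐ[ℚ] L) → Fin 3 → ℤˣ)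
    (f : (Fin 3 → ℤˣ) → L) (hf : ∀ σ, IsIntegral ℤ (f σ)) (h0 : ∀ σ, f σ ≠ 0)
    (hg : ∀ g σ, g (f σ) = f (τ g * σ)) :
    0 ≤ ∑ o, ∑ σ, Real.log (P.val o (f σ)) := by
  obtain ⟨N, hN⟩ := exists_int_prod_eq f hf fun g => ⟨Equiv.mulLeft (τ g), hg g⟩
  have hN0 : N ≠ 0 := by
    rintro rfl
    rw [Int.cast_zero] at hN
    exact Finset.prod_ne_zero_iff.2 (fun σ _ => h0 σ) hN.symm
  have h := P.sum_log_int_nonneg hS hN0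
  rw [hN] at h
  refine h.trans (le_of_eq (Finset.sum_congr rfl fun o _ => ?_))
  rw [map_prod, Real.log_prod fun σ _ => ((P.val o).pos (h0 σ)).ne']

variable {β : Fin 3 → ℤ}

theorem sum_mul_logVec_eq_zero (hS : ∀ p ∈ S, p.Prime) (hβ : ∀ i, β i ≠ 0)
    (hβS : ∀ i, (β i).natAbs.primeFactors ⊆ S) (hz : IsSqTriple β z) (hτ : HasSigns τ z)
    (m : (Fin 3 → ℤˣ) → ℕ) (hm : ∀ g σ, m (τ g * σ) = m σ) :
    ∑ o, ∑ σ, (m σ : ℝ) * (logVec P z o σ 0 + logVec P z o σ 1 + logVec P z o σ 2) = 0 := by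
  have : CharZero L := algebraRat.charZero L
  have hd := hz.diffVec_ne_zero hβ
  have hs := hz.sumVec_ne_zero hβ
  have h1 := P.sum_log_nonneg hS τ (fun σ => (diffVec z σ 0 * diffVec z σ 1 * diffVec z σ 2) ^ m σ)
    (fun σ => (((hz.isIntegral_diffVec _ _).mul (hz.isIntegral_diffVec _ _)).mul
      (hz.isIntegral_diffVec _ _)).pow _)
    (fun σ => pow_ne_zero _ (mul_ne_zero (mul_ne_zero (hd σ 0) (hd σ 1)) (hd σ 2)))
    (fun g σ => by simp only [map_pow, map_mul, hτ.map_diffVec, hm])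
  have h2 := P.sum_log_nonneg hS τ (fun σ => (sumVec z σ 0 * sumVec z σ 1 * sumVec z σ 2) ^ m σ)
    (fun σ => (((hz.isIntegral_sumVec _ _).mul (hz.isIntegral_sumVec _ _)).mul
      (hz.isIntegral_sumVec _ _)).pow _)
    (fun σ => pow_ne_zero _ (mul_ne_zero (mul_ne_zero (hs σ 0) (hs σ 1)) (hs σ 2)))
    (fun g σ => by simp only [map_pow, map_mul, hτ.map_sumVec, hm])
  have e1 : ∀ (x : (Fin 3 → ℤˣ) → Fin 3 → L), (∀ σ i, x σ i ≠ 0) →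
      ∑ o, ∑ σ, Real.log (P.val o ((x σ 0 * x σ 1 * x σ 2) ^ m σ)) =
      ∑ o, ∑ σ, (m σ : ℝ) * (Real.log (P.val o (x σ 0)) + Real.log (P.val o (x σ 1)) +
        Real.log (P.val o (x σ 2))) := by
    intro x hx
    refine Finset.sum_congr rfl fun o _ => Finset.sum_congr rfl fun σ _ => ?_
    have hp : ∀ i, P.val o (x σ i) ≠ 0 := fun i => ((P.val o).pos (hx σ i)).ne'
    rw [map_pow, map_mul, map_mul, Real.log_pow, Real.log_mul (mul_ne_zero (hp 0) (hp 1)) (hp 2),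
      Real.log_mul (hp 0) (hp 1)]
  rw [e1 _ hd] at h1
  rw [e1 _ hs] at h2
  have h3 : ∑ o, ∑ σ, (m σ : ℝ) * (Real.log (P.val o (diffVec z σ 0)) +
      Real.log (P.val o (diffVec z σ 1)) + Real.log (P.val o (diffVec z σ 2))) +
      ∑ o, ∑ σ, (m σ : ℝ) * (Real.log (P.val o (sumVec z σ 0)) +
      Real.log (P.val o (sumVec z σ 1)) + Real.log (P.val o (sumVec z σ 2))) = 0 := by
    have e2 : ∀ o σ i, Real.log (P.val o (diffVec z σ i)) + Real.log (P.val o (sumVec z σ i)) =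
        Real.log (P.val o (β i : L)) := by
      intro o σ i
      rw [← hz.diffVec_mul_sumVec σ i, map_mul,
        Real.log_mul ((P.val o).pos (hd σ i)).ne' ((P.val o).pos (hs σ i)).ne']
    rw [← Finset.sum_add_distrib]
    calc _ = ∑ o, (∑ σ, (m σ : ℝ)) * (Real.log (P.val o (β 0 : L)) + Real.log (P.val o (β 1 : L)) +
          Real.log (P.val o (β 2 : L))) := by
          refine Finset.sum_congr rfl fun o _ => ?_
          rw [← Finset.sum_add_distrib, Finset.sum_mul]
          refine Finset.sum_congr rfl fun σ _ => ?_
          rw [← e2 o σ 0, ← e2 o σ 1, ← e2 o σ 2]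
          ring
      _ = 0 := by
          rw [← Finset.mul_sum, Finset.sum_add_distrib, Finset.sum_add_distrib,
            P.sum_log_int_eq_zero hS (hβ 0) (hβS 0), P.sum_log_int_eq_zero hS (hβ 1) (hβS 1),
            P.sum_log_int_eq_zero hS (hβ 2) (hβS 2)]
          simp
  unfold logVec
  linarith

theorem sum_logVec_eq_zero (hS : ∀ p ∈ S, p.Prime) (hβ : ∀ i, β i ≠ 0)
    (hβS : ∀ i, (β i).natAbs.primeFactors ⊆ S) (hz : IsSqTriple β z) (hτ : HasSigns τ z) :
    ∑ o, ∑ σ, (logVec P z o σ 0 + logVec P z o σ 1 + logVec P z o σ 2) = 0 := by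
  have h := sum_mul_logVec_eq_zero P hS hβ hβS hz hτ (fun _ => 1) (fun _ _ => rfl)
  simpa using h

theorem mul_maxHeight_le (hS : ∀ p ∈ S, p.Prime) (hβ : ∀ i, β i ≠ 0)
    (hβS : ∀ i, (β i).natAbs.primeFactors ⊆ S) (hz : IsSqTriple β z) (hz' : IsSqTriple β z')
    (hτ : HasSigns τ z) (hτ' : HasSigns τ z') (m : (Fin 3 → ℤˣ) → ℕ)
    (hm : ∀ g σ, m (τ g * σ) = m σ)
    (hΔ : ∀ σ, padeDelta (m σ) (diffVec z σ) (diffVec z' σ) ≠ 0) {M : ℕ} (hM : ∀ σ, m σ ≤ M)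
    {c q : ℝ} {e : Option S → (Fin 3 → ℤˣ) → Fin 3 → ℝ}
    (he : ∀ o σ i, logVec P z' o σ i = c * logVec P z o σ i + e o σ i)
    (hc : ∀ σ, 2 * m σ + 1 ≤ c) (hq : ∀ σ, q ≤ 3 * m σ + 2 - c) :
    q * maxHeight (logVec P z) ≤ Real.log 2 + M * Real.log 16 + maxHeight e := by
  have : CharZero L := algebraRat.charZero L
  have h1 := P.sum_log_nonneg hS τ (fun σ => padeDelta (m σ) (diffVec z σ) (diffVec z' σ))
    (fun σ => isIntegral_padeDelta _ (hz.isIntegral_diffVec σ) (hz'.isIntegral_diffVec σ)) hΔ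
    (fun g σ => by rw [hτ.map_padeDelta hτ', hm])
  have h2 : ∑ o, ∑ σ, Real.log (P.val o (padeDelta (m σ) (diffVec z σ) (diffVec z' σ))) ≤
      ∑ o, ∑ σ, (archWeight o * (Real.log 2 + M * Real.log 16) +
        ((m σ : ℝ) * (logVec P z o σ 0 + logVec P z o σ 1 + logVec P z o σ 2) +
        (1 + c + q) / 3 * (logVec P z o σ 0 + logVec P z o σ 1 + logVec P z o σ 2) -
        q * max3 (logVec P z o σ) + max3 (e o σ))) := by
    refine Finset.sum_le_sum fun o _ => Finset.sum_le_sum fun σ _ => ?_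
    have h3 := P.val_padeDelta_le o (m σ) (hz.diffVec_ne_zero hβ σ) (sum_diffVec z σ)
      (hz'.diffVec_ne_zero hβ σ) (sum_diffVec z' σ) (a := logVec P z o σ) (e := e o σ)
      (fun i => rfl) (he o σ) (hc σ) (hq σ)
    have h4 := (Real.log_le_iff_le_exp ((P.val o).pos (hΔ σ))).2 h3
    have h5 : archWeight o * (m σ * Real.log 16) ≤ archWeight o * (M * Real.log 16) := by
      refine mul_le_mul_of_nonneg_left (mul_le_mul_of_nonneg_right (by exact_mod_cast hM σ)
        (Real.log_nonneg (by norm_num))) ?_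
      rcases o with _ | o <;> simp [archWeight]
    linarith
  have h6 : ∑ o : Option S, ∑ σ : Fin 3 → ℤˣ, archWeight o * (Real.log 2 + M * Real.log 16) =
      8 * (Real.log 2 + M * Real.log 16) := by
    simp only [Finset.sum_const, Finset.card_univ, card_signs]
    rw [← Finset.smul_sum, ← Finset.sum_mul, sum_archWeight]
    simp
    ring
  have h7 := sum_mul_logVec_eq_zero P hS hβ hβS hz hτ m hm
  have h8 := sum_logVec_eq_zero P hS hβ hβS hz hτ
  simp only [Finset.sum_add_distrib (M := ℝ), Finset.sum_sub_distrib, ← Finset.mul_sum] at h2 h6 h7 h8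
  unfold maxHeight
  have h9 : (1 + c + q) / 3 * (∑ o, ∑ σ, logVec P z o σ 0 + ∑ o, ∑ σ, logVec P z o σ 1 +
    ∑ o, ∑ σ, logVec P z o σ 2) = 0 := by rw [h8, mul_zero]
  linarith

end Repulsion

section ClassCount

theorem padeDelta_zero {L : Type*} [Field L] (x x' : Fin 3 → L) :
    padeDelta 0 x x' = x' 1 * x 2 - x' 2 * x 1 := by
  simp [padeDelta, padeT, padeW_zero]

theorem padeDelta_zero_ne_zero {L : Type*} [Field L] [CharZero L] {β : Fin 3 → ℤ}
    {z z' : Fin 3 → L} (hβ : ∀ i, β i ≠ 0) (hz : IsSqTriple β z) (hz' : IsSqTriple β z')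
    (hne : z 0 ^ 2 ≠ z' 0 ^ 2) (σ : Fin 3 → ℤˣ) :
    padeDelta 0 (diffVec z σ) (diffVec z' σ) ≠ 0 := by
  rw [padeDelta_zero]
  intro h0
  have hx := hz.diffVec_ne_zero hβ σ
  have hx' := hz'.diffVec_ne_zero hβ σ
  have hs : ∀ i, diffVec z σ i * sumVec z σ i = diffVec z' σ i * sumVec z' σ i := fun i => by
    rw [hz.diffVec_mul_sumVec, hz'.diffVec_mul_sumVec]
  obtain ⟨κ, hκ⟩ : ∃ κ, κ = diffVec z' σ 1 / diffVec z σ 1 := ⟨_, rfl⟩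
  have hκ0 : κ ≠ 0 := by rw [hκ]; exact div_ne_zero (hx' 1) (hx 1)
  have e1 : diffVec z' σ 1 = κ * diffVec z σ 1 := by rw [hκ, div_mul_cancel₀ _ (hx 1)]
  have e2 : diffVec z' σ 2 = κ * diffVec z σ 2 := by
    apply mul_left_cancel₀ (hx 1)
    rw [e1] at h0
    linear_combination -h0
  have e0 : diffVec z' σ 0 = κ * diffVec z σ 0 := by
    linear_combination sum_diffVec z' σ - κ * sum_diffVec z σ - e1 - e2
  have s1 : sumVec z σ 1 = κ * sumVec z' σ 1 := by
    apply mul_left_cancel₀ (hx 1)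
    rw [hs 1, e1]
    ring
  have s2 : sumVec z σ 2 = κ * sumVec z' σ 2 := by
    apply mul_left_cancel₀ (hx 2)
    rw [hs 2, e2]
    ring
  have hd : ∀ y : Fin 3 → L, sumVec y σ 2 - sumVec y σ 1 = diffVec y σ 0 := by
    intro y
    simp only [diffVec, sumVec, zero_add, show (1 : Fin 3) + 1 = 2 from rfl,
      show (1 : Fin 3) + 2 = 0 from rfl, show (2 : Fin 3) + 1 = 0 from rfl,
      show (2 : Fin 3) + 2 = 1 from rfl]
    ring
  have hκ2 : κ ^ 2 = 1 := by
    apply mul_right_cancel₀ (hx 0)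
    have h1 := hd z
    have h2 := hd z'
    linear_combination -κ * e0 - κ * h2 + h1 - s2 + s1
  have hy : ∀ y : Fin 3 → L, sumVec y σ 1 - diffVec y σ 1 = 2 * (((σ 0 : ℤ) : L) * y 0) := by
    intro y
    simp only [diffVec, sumVec, show (1 : Fin 3) + 1 = 2 from rfl,
      show (1 : Fin 3) + 2 = 0 from rfl]
    ring
  apply hne
  have h3 : ((σ 0 : ℤ) : L) * z 0 = κ * (((σ 0 : ℤ) : L) * z' 0) := by
    have h2 : (2 : L) ≠ 0 := two_ne_zero
    apply mul_left_cancel₀ h2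
    linear_combination hy z' * κ - hy z + s1 + e1 * κ + diffVec z σ 1 * hκ2
  have h4 := congrArg (· ^ 2) h3
  simp only [mul_pow, cast_units_sq, hκ2, one_mul] at h4
  exact h4

variable {S : Finset ℕ}

theorem maxHeight_add_le (u v : Option S → (Fin 3 → ℤˣ) → Fin 3 → ℝ) :
    maxHeight (u + v) ≤ maxHeight u + maxHeight v := by
  unfold maxHeight
  rw [← add_div, ← Finset.sum_add_distrib]
  refine div_le_div_of_nonneg_right (Finset.sum_le_sum fun o _ => ?_) (by norm_num)
  rw [← Finset.sum_add_distrib]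
  exact Finset.sum_le_sum fun σ _ => max3_add_le (u o σ) (v o σ)

theorem maxHeight_smul {c : ℝ} (hc : 0 ≤ c) (u : Option S → (Fin 3 → ℤˣ) → Fin 3 → ℝ) :
    maxHeight (c • u) = c * maxHeight u := by
  unfold maxHeight
  rw [← mul_div_assoc, Finset.mul_sum]
  congr 1
  refine Finset.sum_congr rfl fun o _ => ?_
  rw [Finset.mul_sum]
  exact Finset.sum_congr rfl fun σ _ => max3_mul hc (u o σ)

/-- The even part of the averaged maximum. -/
def maxSeminorm {E : Type*} [AddCommGroup E] [Module ℝ E]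
    (Φ : E →ₗ[ℝ] (Option S → (Fin 3 → ℤˣ) → Fin 3 → ℝ)) : Seminorm ℝ E :=
  Seminorm.of (fun e => max (maxHeight (Φ e)) (maxHeight (Φ (-e))))
    (fun x y => by
      refine max_le ?_ ?_
      · rw [map_add]
        exact (maxHeight_add_le _ _).trans (add_le_add (le_max_left _ _) (le_max_left _ _))
      · rw [neg_add, map_add]
        exact (maxHeight_add_le _ _).trans (add_le_add (le_max_right _ _) (le_max_right _ _)))
    (fun c x => by
      rcases le_total 0 c with hc | hc
      · rw [← smul_neg, map_smul, map_smul, maxHeight_smul hc, maxHeight_smul hc,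
          Real.norm_of_nonneg hc, mul_max_of_nonneg _ _ hc]
      · have h1 : c • x = (-c) • (-x) := by simp
        have h2 : -(c • x) = (-c) • x := by simp
        rw [h2, h1, map_smul, map_smul, maxHeight_smul (neg_nonneg.2 hc),
          maxHeight_smul (neg_nonneg.2 hc), Real.norm_of_nonpos hc,
          mul_max_of_nonneg _ _ (neg_nonneg.2 hc), max_comm])

theorem maxSeminorm_apply {E : Type*} [AddCommGroup E] [Module ℝ E]
    (Φ : E →ₗ[ℝ] (Option S → (Fin 3 → ℤˣ) → Fin 3 → ℝ)) (e : E) :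
    maxSeminorm Φ e = max (maxHeight (Φ e)) (maxHeight (-Φ e)) := by
  rw [← map_neg]
  rfl

theorem max3_neg_le (f : Fin 3 → ℝ) : max3 (-f) ≤ 2 * max3 f - (f 0 + f 1 + f 2) := by
  have h := le_max3 f
  refine max3_le fun i => ?_
  rw [sum_three_eq f i, Pi.neg_apply]
  linarith [h (i + 1), h (i + 2)]

theorem sum_le_three_max3 (f : Fin 3 → ℝ) : f 0 + f 1 + f 2 ≤ 3 * max3 f := by
  linarith [le_max3 f 0, le_max3 f 1, le_max3 f 2]

theorem maxHeight_neg_le {u : Option S → (Fin 3 → ℤˣ) → Fin 3 → ℝ}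
    (hu : ∑ o, ∑ σ, (u o σ 0 + u o σ 1 + u o σ 2) = 0) :
    maxHeight (-u) ≤ 2 * maxHeight u := by
  have h : ∑ o, ∑ σ, max3 ((-u) o σ) ≤
      ∑ o, ∑ σ, (2 * max3 (u o σ) - (u o σ 0 + u o σ 1 + u o σ 2)) :=
    Finset.sum_le_sum fun o _ => Finset.sum_le_sum fun σ _ => max3_neg_le (u o σ)
  simp only [Finset.sum_sub_distrib, ← Finset.mul_sum] at h
  rw [hu] at h
  unfold maxHeight
  linarith

theorem maxHeight_nonneg {u : Option S → (Fin 3 → ℤˣ) → Fin 3 → ℝ}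
    (hu : ∑ o, ∑ σ, (u o σ 0 + u o σ 1 + u o σ 2) = 0) : 0 ≤ maxHeight u := by
  have h : ∑ o, ∑ σ, (u o σ 0 + u o σ 1 + u o σ 2) ≤ ∑ o, ∑ σ, 3 * max3 (u o σ) :=
    Finset.sum_le_sum fun o _ => Finset.sum_le_sum fun σ _ => sum_le_three_max3 (u o σ)
  rw [hu] at h
  simp only [← Finset.mul_sum] at h
  unfold maxHeight
  linarith

/-- The linear map producing the vectors `logVec` out of finitely many parameters. -/
def paramMap (A : Option S → Fin 3 → ℝ) :
    (ℝ × (Option S × Fin 3 → ℝ)) →ₗ[ℝ] (Option S → (Fin 3 → ℤˣ) → Fin 3 → ℝ) where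
  toFun m o σ i := m.1 * A o i - (((σ (i + 1) * σ (i + 2) : ℤˣ) : ℤ) : ℝ) * m.2 (o, i)
  map_add' m m' := by
    ext o σ i
    simp only [Prod.fst_add, Prod.snd_add, Pi.add_apply]
    ring
  map_smul' c m := by
    ext o σ i
    simp only [Prod.smul_fst, Prod.smul_snd, Pi.smul_apply, smul_eq_mul, RingHom.id_apply]
    ring

variable {L : Type*} [Field L] (P : PlaceFamily L S)

theorem exists_paramMap_eq [CharZero L] {β : Fin 3 → ℤ} (hβ : ∀ i, β i ≠ 0) {z : Fin 3 → L}
    (hz : IsSqTriple β z) : ∃ m : ℝ × (Option S × Fin 3 → ℝ),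
      paramMap (fun o i => Real.log (P.val o (β i : L))) m = logVec P z := by
  refine ⟨(1 / 2, fun q => (Real.log (P.val q.1 (sumVec z 1 q.2)) -
    Real.log (P.val q.1 (diffVec z 1 q.2))) / 2), ?_⟩
  ext o σ i
  have hd := hz.diffVec_ne_zero hβ 1 i
  have hs := hz.sumVec_ne_zero hβ 1 i
  have h1 : Real.log (P.val o (β i : L)) =
      Real.log (P.val o (diffVec z 1 i)) + Real.log (P.val o (sumVec z 1 i)) := by
    rw [← hz.diffVec_mul_sumVec 1 i, map_mul,
      Real.log_mul ((P.val o).pos hd).ne' ((P.val o).pos hs).ne']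
  show 1 / 2 * Real.log (P.val o (β i : L)) - _ * ((Real.log (P.val o (sumVec z 1 i)) -
    Real.log (P.val o (diffVec z 1 i))) / 2) = Real.log (P.val o (diffVec z σ i))
  rw [h1]
  have key : ∀ u v : ℤˣ, σ (i + 1) = u → σ (i + 2) = v →
      diffVec z σ i = ((u : ℤ) : L) * z (i + 1) - ((v : ℤ) : L) * z (i + 2) := by
    rintro u v rfl rfl
    rfl
  have hd1 : diffVec z 1 i = z (i + 1) - z (i + 2) := by simp [diffVec]
  have hs1 : sumVec z 1 i = z (i + 1) + z (i + 2) := by simp [sumVec]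
  rcases Int.units_eq_one_or (σ (i + 1)) with hu | hu <;>
  rcases Int.units_eq_one_or (σ (i + 2)) with hv | hv <;>
  rw [key _ _ hu hv, hu, hv, hd1, hs1]
  · have : ((1 : ℤˣ) : ℤ) * z (i + 1) - ((1 : ℤˣ) : ℤ) * z (i + 2) = z (i + 1) - z (i + 2) := by
      simp
    rw [this]
    push_cast
    ring
  · have : ((1 : ℤˣ) : ℤ) * z (i + 1) - ((-1 : ℤˣ) : ℤ) * z (i + 2) = z (i + 1) + z (i + 2) := by
      simp
    rw [this]
    push_cast
    ring
  · have : ((-1 : ℤˣ) : ℤ) * z (i + 1) - ((1 : ℤˣ) : ℤ) * z (i + 2) = -(z (i + 1) + z (i + 2)) := by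
      simp
      ring
    rw [this, (P.val o).map_neg]
    push_cast
    ring
  · have : ((-1 : ℤˣ) : ℤ) * z (i + 1) - ((-1 : ℤˣ) : ℤ) * z (i + 2) = -(z (i + 1) - z (i + 2)) := by
      simp
      ring
    rw [this, (P.val o).map_neg]
    push_cast
    ring

variable [Algebra ℚ L] [IsGalois ℚ L]

theorem card_le_of_hasSigns (hS : ∀ p ∈ S, p.Prime) {β : Fin 3 → ℤ} (hβ : ∀ i, β i ≠ 0)
    (hβS : ∀ i, (β i).natAbs.primeFactors ⊆ S) {τ : (L ≃ₐ[ℚ] L) → Fin 3 → ℤˣ} {ι : Type*}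
    (T : Finset ι) (z : ι → Fin 3 → L) (hz : ∀ i ∈ T, IsSqTriple β (z i))
    (hτ : ∀ i ∈ T, HasSigns τ (z i)) (h6 : ∀ i ∈ T, 6 ≤ maxHeight (logVec P (z i)))
    (hne : ∀ i ∈ T, ∀ j ∈ T, i ≠ j → z i 0 ^ 2 ≠ z j 0 ^ 2) :
    T.card ≤ 8 * 101 ^ (3 * S.card + 4) := by
  have : CharZero L := algebraRat.charZero L
  have hex : ∀ i, ∃ m : ℝ × (Option S × Fin 3 → ℝ), i ∈ T →
      paramMap (fun o i => Real.log (P.val o (β i : L))) m = logVec P (z i) := by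
    intro i
    by_cases hi : i ∈ T
    · obtain ⟨m, hm⟩ := exists_paramMap_eq P hβ (hz i hi)
      exact ⟨m, fun _ => hm⟩
    · exact ⟨0, fun h => absurd h hi⟩
  choose a ha using hex
  set Φ := paramMap (fun o i => Real.log (P.val o (β i : L))) with hΦ
  have hfin : Module.finrank ℝ (ℝ × (Option S × Fin 3 → ℝ)) = 3 * S.card + 4 := by
    simp
    ring
  have hvec : ∀ i ∈ T, ∀ j ∈ T, ∀ (c : ℝ) e, a j = c • a i + e → ∀ o σ l,
      logVec P (z j) o σ l = c * logVec P (z i) o σ l + Φ e o σ l := by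
    intro i hi j hj c e h o σ l
    rw [← ha i hi, ← ha j hj, h, map_add, map_smul]
    rfl
  rw [← hfin]
  refine card_le_of_repulsion (maxSeminorm Φ) (fun e => maxHeight (Φ e)) ?_ T a ?_ ?_ ?_ ?_
  · intro e
    rw [maxSeminorm_apply]
    exact le_max_left _ _
  · intro i hi
    rw [ha i hi]
    exact h6 i hi
  · intro i hi
    have h0 := sum_logVec_eq_zero P hS hβ hβS (hz i hi) (hτ i hi)
    rw [maxSeminorm_apply, ha i hi]
    exact max_le (by linarith [maxHeight_nonneg h0]) (maxHeight_neg_le h0)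
  · intro i hi j hj hij c e he hc1 hc2
    have h := mul_maxHeight_le P hS hβ hβS (hz i hi) (hz j hj) (hτ i hi) (hτ j hj) (fun _ => 0)
      (fun _ _ => rfl) (fun σ => padeDelta_zero_ne_zero hβ (hz i hi) (hz j hj) (hne i hi j hj hij) σ)
      (M := 0) (fun _ => le_rfl) (q := 2 - c) (hvec i hi j hj c e he) (fun _ => by simpa using hc1)
      (fun _ => by simp)
    rw [ha i hi]
    simpa using h
  · intro i hi j hj hij n c e he hc1 hc2
    have hor := fun σ => padeDelta_ne_zero_or n ((hz i hi).diffVec_ne_zero hβ σ)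
      (sum_diffVec (z i) σ) ((hz j hj).diffVec_ne_zero hβ σ) (sum_diffVec (z j) σ)
      ((hz i hi).not_equilateral hβ σ)
    have h := mul_maxHeight_le P hS hβ hβS (hz i hi) (hz j hj) (hτ i hi) (hτ j hj)
      (fun σ => if padeDelta n (diffVec (z i) σ) (diffVec (z j) σ) = 0 then n + 1 else n)
      (fun g σ => by
        have h1 := (hτ i hi).map_padeDelta (hτ j hj) g σ n
        have h2 : padeDelta n (diffVec (z i) (τ g * σ)) (diffVec (z j) (τ g * σ)) = 0 ↔
            padeDelta n (diffVec (z i) σ) (diffVec (z j) σ) = 0 := by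
          rw [← h1, map_eq_zero_iff g g.injective]
        simp only [h2])
      (fun σ => by
        by_cases h0 : padeDelta n (diffVec (z i) σ) (diffVec (z j) σ) = 0
        · simp only [h0, if_true]
          exact (hor σ).resolve_left (not_not.2 h0)
        · simp only [h0, if_false]
          exact h0)
      (M := n + 1) (fun σ => by split_ifs <;> omega) (q := 3 * n + 2 - c)
      (hvec i hi j hj c e he)
      (fun σ => by split_ifs <;> push_cast <;> linarith)
      (fun σ => by split_ifs <;> push_cast <;> linarith)
    rw [ha i hi]
    push_cast at h
    exact h

end ClassCount

section SmallHeight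

variable {L : Type*} [Field L]

theorem diffVec_flip_one_two (z : Fin 3 → L) (σ : Fin 3 → ℤˣ) :
    diffVec z (Pi.mulSingle 1 (-1) * σ) 2 = sumVec z σ 2 := by
  simp [diffVec, sumVec, show (2 : Fin 3) + 1 = 0 from rfl,
    show (2 : Fin 3) + 2 = 1 from rfl]

theorem diffVec_flip_two_two (z : Fin 3 → L) (σ : Fin 3 → ℤˣ) :
    diffVec z (Pi.mulSingle 2 (-1) * σ) 2 = diffVec z σ 2 := by
  simp [diffVec, show (2 : Fin 3) + 1 = 0 from rfl,
    show (2 : Fin 3) + 2 = 1 from rfl]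

theorem diffVec_flip_two_zero (z : Fin 3 → L) (σ : Fin 3 → ℤˣ) :
    diffVec z (Pi.mulSingle 2 (-1) * σ) 0 = sumVec z σ 0 := by
  simp [diffVec, sumVec]

theorem sum_signs_le {M : (Fin 3 → ℤˣ) → ℝ} {b : ℝ} (ρ ρ' : Fin 3 → ℤˣ)
    (h : ∀ σ, b ≤ M σ + M (ρ' * σ) + (M (ρ * σ) + M (ρ' * (ρ * σ)))) :
    2 * b ≤ ∑ σ, M σ := by
  have h1 := Finset.sum_le_sum fun σ (_ : σ ∈ Finset.univ) => h σ
  have e : ∀ (ρ : Fin 3 → ℤˣ) (N : (Fin 3 → ℤˣ) → ℝ), ∑ σ, N (ρ * σ) = ∑ σ, N σ := fun ρ N =>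
    Equiv.sum_comp (Equiv.mulLeft ρ) N
  rw [Finset.sum_const, Finset.card_univ, card_signs, Finset.sum_add_distrib,
    Finset.sum_add_distrib, Finset.sum_add_distrib, e _ M, e _ M,
    e ρ fun σ => M (ρ' * σ), e _ M, nsmul_eq_mul] at h1
  push_cast at h1
  linarith

variable [CharZero L] {S : Finset ℕ} (P : PlaceFamily L S) {β : Fin 3 → ℤ} {z : Fin 3 → L}

theorem log_max_le_sum_max3 (hβ : ∀ i, β i ≠ 0) (hz : IsSqTriple β z) (o : Option S) :
    2 * (2 * (Real.log (max (P.val o (z 0)) (P.val o (z 1))) + Real.log (P.val o ((2 : ℤ) : L)) -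
      archWeight o * Real.log 2) + Real.log (P.val o (β 0 : L))) ≤
    ∑ σ, max3 (logVec P z o σ) := by
  have h20 : ((2 : ℤ) : L) ≠ 0 := by norm_num
  have hmax : 0 < max (P.val o (z 0)) (P.val o (z 1)) := by
    by_contra! h
    have h0 := (P.val o).nonpos_iff.1 ((le_max_left _ _).trans h)
    have h1 := (P.val o).nonpos_iff.1 ((le_max_right _ _).trans h)
    apply hz.diffVec_ne_zero hβ 1 2
    simp [diffVec, show (2 : Fin 3) + 1 = 0 from rfl, show (2 : Fin 3) + 2 = 1 from rfl, h0, h1]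
  have hprod : ∀ σ, Real.log (P.val o (β 0 : L)) ≤ max3 (logVec P z o σ) +
      max3 (logVec P z o (Pi.mulSingle 2 (-1) * σ)) := by
    intro σ
    have h1 := le_max3 (logVec P z o σ) 0
    have h2 := le_max3 (logVec P z o (Pi.mulSingle 2 (-1) * σ)) 0
    rw [logVec, diffVec_flip_two_zero] at h2
    rw [logVec] at h1
    rw [← hz.diffVec_mul_sumVec σ 0, map_mul,
      Real.log_mul ((P.val o).pos (hz.diffVec_ne_zero hβ σ 0)).ne'
        ((P.val o).pos (hz.sumVec_ne_zero hβ σ 0)).ne']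
    linarith
  have hdiff : ∀ σ, 2 * Real.log (P.val o (diffVec z σ 2)) ≤ max3 (logVec P z o σ) +
      max3 (logVec P z o (Pi.mulSingle 2 (-1) * σ)) := by
    intro σ
    have h1 := le_max3 (logVec P z o σ) 2
    have h2 := le_max3 (logVec P z o (Pi.mulSingle 2 (-1) * σ)) 2
    rw [logVec, diffVec_flip_two_two] at h2
    rw [logVec] at h1
    linarith
  refine sum_signs_le (Pi.mulSingle 1 (-1)) (Pi.mulSingle 2 (-1)) fun σ => ?_
  have h1 := hdiff σ
  have h2 := hdiff (Pi.mulSingle 1 (-1) * σ)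
  rw [diffVec_flip_one_two] at h2
  have h3 := hprod σ
  have h4 := hprod (Pi.mulSingle 1 (-1) * σ)
  have hx := (P.val o).pos (hz.diffVec_ne_zero hβ σ 2)
  have hs := (P.val o).pos (hz.sumVec_ne_zero hβ σ 2)
  set B := max (Real.log (P.val o (diffVec z σ 2))) (Real.log (P.val o (sumVec z σ 2))) with hB
  have hxB : P.val o (diffVec z σ 2) ≤ Real.exp B :=
    (Real.log_le_iff_le_exp hx).1 (le_max_left _ _)
  have hsB : P.val o (sumVec z σ 2) ≤ Real.exp B :=
    (Real.log_le_iff_le_exp hs).1 (le_max_right _ _)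
  have hunit : ∀ u : ℤˣ, P.val o ((u : ℤ) : L) = 1 := by
    intro u
    rcases Int.units_eq_one_or u with rfl | rfl <;> simp
  have h5 : P.val o ((2 : ℤ) : L) * P.val o (z 0) ≤
      Real.exp (archWeight o * Real.log 2 + B) := by
    have h := P.val_add_le o hxB hsB
    have e : diffVec z σ 2 + sumVec z σ 2 = ((2 : ℤ) : L) * (((σ 0 : ℤ) : L) * z 0) := by
      simp only [diffVec, sumVec, show (2 : Fin 3) + 1 = 0 from rfl]
      push_cast
      ring
    rwa [e, map_mul, map_mul, hunit, one_mul] at h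
  have h6 : P.val o ((2 : ℤ) : L) * P.val o (z 1) ≤
      Real.exp (archWeight o * Real.log 2 + B) := by
    have h := P.val_add_le o (x := -diffVec z σ 2) (by rwa [(P.val o).map_neg]) hsB
    have e : -diffVec z σ 2 + sumVec z σ 2 = ((2 : ℤ) : L) * (((σ 1 : ℤ) : L) * z 1) := by
      simp only [diffVec, sumVec, show (2 : Fin 3) + 2 = 1 from rfl]
      push_cast
      ring
    rwa [e, map_mul, map_mul, hunit, one_mul] at h
  have h7 : Real.log (max (P.val o (z 0)) (P.val o (z 1))) + Real.log (P.val o ((2 : ℤ) : L)) ≤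
      archWeight o * Real.log 2 + B := by
    have hv2 := (P.val o).pos h20
    rw [← Real.log_mul hmax.ne' hv2.ne', Real.log_le_iff_le_exp (mul_pos hmax hv2), mul_comm]
    rcases max_choice (P.val o (z 0)) (P.val o (z 1)) with h | h <;> rw [h] <;> assumption
  rcases max_choice (Real.log (P.val o (diffVec z σ 2))) (Real.log (P.val o (sumVec z σ 2)))
    with h | h <;> rw [← hB] at h <;> linarith

theorem exists_local_bounds (hS : ∀ p ∈ S, p.Prime) (h2S : 2 ∈ S) (hβ : ∀ i, β i ≠ 0)
    (hβS : (β 0).natAbs.primeFactors ⊆ S) {w : Fin 3 → ℤ} (hw : ∀ i, z i ^ 2 = w i)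
    (hz : IsSqTriple β z) : ∃ m : Option S → ℝ,
      (∀ o, P.val o (w 0 : L) ≤ Real.exp (m o) ∧ P.val o (w 1 : L) ≤ Real.exp (m o)) ∧
      ∑ o, m o ≤ 4 * maxHeight (logVec P z) + 2 * Real.log 2 := by
  refine ⟨fun o => 2 * Real.log (max (P.val o (z 0)) (P.val o (z 1))), fun o => ?_, ?_⟩
  · have key : ∀ i, P.val o (z i) ≤ max (P.val o (z 0)) (P.val o (z 1)) →
        P.val o (w i : L) ≤ Real.exp (2 * Real.log (max (P.val o (z 0)) (P.val o (z 1)))) := by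
      intro i hi
      rw [← hw, map_pow, two_mul, Real.exp_add, ← sq]
      exact pow_le_pow_left₀ ((P.val o).nonneg _) (hi.trans (Real.le_exp_log _)) 2
    exact ⟨key 0 (le_max_left _ _), key 1 (le_max_right _ _)⟩
  · have h := Finset.sum_le_sum fun o (_ : o ∈ Finset.univ) => log_max_le_sum_max3 P hβ hz o
    have h2 := P.sum_log_int_eq_zero hS (N := 2) (by norm_num)
      (by simpa [Nat.primeFactors, Nat.primeFactorsList] using h2S)
    have h3 := P.sum_log_int_eq_zero hS (hβ 0) hβS
    simp only [← Finset.mul_sum, Finset.sum_add_distrib, Finset.sum_sub_distrib,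
      ← Finset.sum_mul, sum_archWeight, h2, h3] at h
    rw [← Finset.mul_sum]
    unfold maxHeight
    linarith

theorem abs_div_gcd_le (hS : ∀ p ∈ S, p.Prime) {a b : ℤ} (hab : a ≠ b)
    (habS : (a - b).natAbs.primeFactors ⊆ S) {m : Option S → ℝ} {C : ℝ}
    (hm : ∀ o, P.val o (a : L) ≤ Real.exp (m o) ∧ P.val o (b : L) ≤ Real.exp (m o))
    (hC : ∑ o, m o ≤ C) :
    |((a / Int.gcd a b : ℤ) : ℝ)| ≤ Real.exp C ∧ |((b / Int.gcd a b : ℤ) : ℝ)| ≤ Real.exp C := by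
  have hg0 : (Int.gcd a b : ℤ) ≠ 0 := by
    intro h
    have := Int.gcd_eq_zero_iff.1 (Int.natCast_eq_zero.1 h)
    exact hab (this.1.trans this.2.symm)
  have hgd : (Int.gcd a b : ℤ) ∣ a - b := dvd_sub (Int.gcd_dvd_left ..) (Int.gcd_dvd_right ..)
  have hgS : (Int.gcd a b : ℤ).natAbs.primeFactors ⊆ S :=
    (Nat.primeFactors_mono (Int.natAbs_dvd_natAbs.2 hgd)
      (Int.natAbs_ne_zero.2 (sub_ne_zero.2 hab))).trans habS
  have h1 := P.sum_log_int_eq_zero hS hg0 hgS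
  rw [Fintype.sum_option] at h1 hC
  have h2 : ∀ p : S, Real.log (P.val (some p) ((Int.gcd a b : ℤ) : L)) ≤ m (some p) := by
    intro p
    have hpos := (P.val (some p)).pos (Int.cast_ne_zero (α := L).2 hg0)
    rw [Real.log_le_iff_le_exp hpos, Int.gcd_eq_gcd_ab]
    push_cast
    have h0 : ∀ n : ℤ, P.val (some p) (n : L) ≤ 1 := fun n => by
      have : Fact (p : ℕ).Prime := ⟨hS p p.2⟩
      rw [P.val_some_int]
      exact_mod_cast padicNorm.of_int (p := (p : ℕ)) n
    refine (P.nonarch p _ _).trans (max_le ?_ ?_)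
    · rw [map_mul]
      exact (mul_le_of_le_one_right ((P.val _).nonneg _) (h0 _)).trans (hm (some p)).1
    · rw [map_mul]
      exact (mul_le_of_le_one_right ((P.val _).nonneg _) (h0 _)).trans (hm (some p)).2
  have h3 := Finset.sum_le_sum fun p (_ : p ∈ (Finset.univ : Finset S)) => h2 p
  have hgp : 0 < |((Int.gcd a b : ℤ) : ℝ)| := abs_pos.2 (Int.cast_ne_zero.2 hg0)
  have h4 : Real.exp (m none) ≤ Real.exp C * |((Int.gcd a b : ℤ) : ℝ)| := by
    rw [← Real.exp_log hgp, ← Real.exp_add, Real.exp_le_exp, ← P.val_none_int]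
    linarith
  have key : ∀ n : ℤ, (Int.gcd a b : ℤ) ∣ n → P.val none (n : L) ≤ Real.exp (m none) →
      |((n / Int.gcd a b : ℤ) : ℝ)| ≤ Real.exp C := by
    intro n hn hle
    rw [P.val_none_int] at hle
    refine le_of_mul_le_mul_right ?_ hgp
    rw [← abs_mul, ← Int.cast_mul, Int.ediv_mul_cancel hn]
    exact hle.trans h4
  exact ⟨key a (Int.gcd_dvd_left ..) (hm none).1, key b (Int.gcd_dvd_right ..) (hm none).2⟩

theorem exp_lt_of_small {h : ℝ} (hh : h < 6) :
    Real.exp (4 * h + 2 * Real.log 2) < 107000000000 := by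
  have h1 : Real.exp (4 * h + 2 * Real.log 2) < Real.exp ((24 : ℕ) * 1 + (2 : ℕ) * Real.log 2) := by
    rw [Real.exp_lt_exp]
    push_cast
    linarith
  refine h1.trans ?_
  rw [Real.exp_add, Real.exp_nat_mul, Real.exp_nat_mul, Real.exp_log two_pos]
  have h2 : Real.exp 1 ^ 24 ≤ 2.7183 ^ 24 :=
    pow_le_pow_left₀ (Real.exp_pos 1).le (by linarith [Real.exp_one_lt_d9]) 24
  calc Real.exp 1 ^ 24 * 2 ^ 2 ≤ 2.7183 ^ 24 * 2 ^ 2 :=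
        mul_le_mul_of_nonneg_right h2 (by norm_num)
    _ < _ := by norm_num

theorem card_le_of_small (hS : ∀ p ∈ S, p.Prime) (h2S : 2 ∈ S) (hβ : ∀ i, β i ≠ 0)
    (hβS : ∀ i, (β i).natAbs.primeFactors ⊆ S) (T : Finset ℤ) (w : ℤ → Fin 3 → ℤ)
    (z : ℤ → Fin 3 → L) (hw : ∀ X ∈ T, ∀ i, z X i ^ 2 = w X i)
    (hwβ : ∀ X i, w X (i + 1) - w X (i + 2) = β i) (hinj : ∀ X, w X 0 = X)
    {B : ℕ}
    (hsmall : ∀ X ∈ T, Real.exp (4 * maxHeight (logVec P (z X)) + 2 * Real.log 2) ≤ B) :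
    T.card ≤ (2 * B + 1) ^ 2 := by
  have hdiff : ∀ X, w X 0 - w X 1 = β 2 := fun X => hwβ X 2
  have hsub : ∀ X, w X 0 ≠ w X 1 := fun X h => hβ 2 (by rw [← hdiff X, h, sub_self])
  let F : ℤ → ℤ × ℤ := fun X => (w X 0 / Int.gcd (w X 0) (w X 1), w X 1 / Int.gcd (w X 0) (w X 1))
  have hmaps : ∀ X ∈ T, F X ∈ Finset.Icc (-B : ℤ) B ×ˢ
      Finset.Icc (-B : ℤ) B := by
    intro X hX
    obtain ⟨m, hm1, hm2⟩ := exists_local_bounds P hS h2S hβ (hβS 0) (hw X hX)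
      ⟨w X, hw X hX, hwβ X⟩
    have h := abs_div_gcd_le P hS (hsub X) (by rw [hdiff]; exact hβS 2) hm1 hm2
    have key : ∀ n : ℤ, |(n : ℝ)| ≤ Real.exp (4 * maxHeight (logVec P (z X)) + 2 * Real.log 2) →
        n ∈ Finset.Icc (-B : ℤ) B := by
      intro n hn
      have := abs_le.1 (hn.trans (hsmall X hX))
      rw [Finset.mem_Icc]
      exact_mod_cast this
    exact Finset.mem_product.2 ⟨key _ h.1, key _ h.2⟩
  have hF : Set.InjOn F T := by
    have hmul : ∀ X, (F X).1 * Int.gcd (w X 0) (w X 1) = X := fun X => by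
      rw [Int.ediv_mul_cancel (Int.gcd_dvd_left ..), hinj]
    have hmul' : ∀ X, (F X).2 * Int.gcd (w X 0) (w X 1) = w X 1 := fun X =>
      Int.ediv_mul_cancel (Int.gcd_dvd_right ..)
    intro X _ X' _ h
    have e1 : ((F X).1 - (F X).2) * Int.gcd (w X 0) (w X 1) = β 2 := by
      rw [sub_mul, hmul, hmul', ← hdiff X, hinj]
    have e2 : ((F X).1 - (F X).2) * Int.gcd (w X' 0) (w X' 1) = β 2 := by
      rw [h, sub_mul, hmul, hmul', ← hdiff X', hinj]
    have h0 : (F X).1 - (F X).2 ≠ 0 := fun h0 => hβ 2 (by rw [← e1, h0, zero_mul])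
    have e3 := mul_left_cancel₀ h0 (e1.trans e2.symm)
    rw [← hmul X, ← hmul X', h, e3]
  refine (Finset.card_le_card_of_injOn F hmaps hF).trans (le_of_eq ?_)
  rw [Finset.card_product, Int.card_Icc, sq]
  congr 1 <;> omega

end SmallHeight

section SquareClasses

theorem exists_eq_unit_mul_prod_mul_sq {S : Finset ℕ} {n : ℤ} (hn : n ≠ 0)
    (h : ∀ p : ℕ, p.Prime → p ∉ S → Even (n.natAbs.factorization p)) :
    ∃ (κ : ℤˣ × {A // A ∈ S.powerset}) (y : ℤ), n = (κ.1 : ℤ) * (∏ p ∈ κ.2.1, (p : ℤ)) * y ^ 2 := by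
  obtain ⟨a, b, hab, ha⟩ := Nat.sq_mul_squarefree n.natAbs
  have hn0 : n.natAbs ≠ 0 := Int.natAbs_ne_zero.2 hn
  have hb0 : b ≠ 0 := by
    rintro rfl
    simp at hab
    exact hn0 hab.symm
  have ha0 := ha.ne_zero
  have hA : a.primeFactors ∈ S.powerset := by
    rw [Finset.mem_powerset]
    intro p hp
    by_contra hpS
    have hpp := Nat.prime_of_mem_primeFactors hp
    have h1 := h p hpp hpS
    rw [← hab, Nat.factorization_mul (pow_ne_zero 2 hb0) ha0, Nat.factorization_pow] at h1
    have h2 : a.factorization p = 1 := le_antisymm (ha.natFactorization_le_one p)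
      ((hpp.dvd_iff_one_le_factorization ha0).1 (Nat.dvd_of_mem_primeFactors hp))
    simp [h2, parity_simps] at h1
  obtain ⟨u, hu⟩ : ∃ u : ℤˣ, n = u * (n.natAbs : ℤ) := by
    rcases Int.natAbs_eq n with h1 | h1
    · exact ⟨1, by rw [Units.val_one, one_mul]; exact h1⟩
    · exact ⟨-1, by rw [Units.val_neg, Units.val_one, neg_one_mul]; exact h1⟩
  refine ⟨(u, ⟨_, hA⟩), b, ?_⟩
  have h3 := Nat.prod_primeFactors_of_squarefree ha
  have h4 : (∏ p ∈ a.primeFactors, (p : ℤ)) = a := by rw [← Nat.cast_prod, h3]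
  show n = u * (∏ p ∈ a.primeFactors, (p : ℤ)) * (b : ℤ) ^ 2
  rw [h4, hu, ← hab]
  push_cast
  rcases Int.units_eq_one_or u with rfl | rfl <;> ring

theorem card_le_of_even_factorization_aux (L : Type*) [Field L] [Algebra ℚ L] [IsGalois ℚ L]
    [IsAlgClosed L] {S : Finset ℕ} (hS : ∀ p ∈ S, p.Prime) (h2S : 2 ∈ S) (c : Fin 3 → ℤ)
    (hc0 : c 0 = 0) (hc : ∀ i, c (i + 1) - c (i + 2) ≠ 0)
    (hcS : ∀ i, (c (i + 1) - c (i + 2)).natAbs.primeFactors ⊆ S) (T : Finset ℤ)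
    (hT : ∀ X ∈ T, ∀ i, X + c i ≠ 0 ∧
      ∀ p : ℕ, p.Prime → p ∉ S → Even ((X + c i).natAbs.factorization p)) :
    T.card ≤ 214000000001 ^ 2 + 8 * 101 ^ (3 * S.card + 4) * (2 * 2 ^ S.card) ^ 3 := by
  have : CharZero L := algebraRat.charZero L
  obtain ⟨P⟩ := nonempty_placeFamily L hS
  have hroot : ∀ κ : ℤˣ × {A // A ∈ S.powerset}, ∃ r : L,
      r ^ 2 = (((κ.1 : ℤ) * (∏ p ∈ κ.2.1, (p : ℤ)) : ℤ) : L) := fun κ =>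
    IsAlgClosed.exists_pow_nat_eq _ two_pos
  choose r hr using hroot
  have hsign : ∀ (κ : ℤˣ × {A // A ∈ S.powerset}) (g : L ≃ₐ[ℚ] L), ∃ u : ℤˣ,
      g (r κ) = ((u : ℤ) : L) * r κ := by
    intro κ g
    have h1 : g (r κ) ^ 2 = r κ ^ 2 := by rw [← map_pow, hr, map_intCast]
    rcases sq_eq_sq_iff_eq_or_eq_neg.1 h1 with h | h
    · exact ⟨1, by simp [h]⟩
    · exact ⟨-1, by simp [h]⟩
  choose u hu using hsign
  have hex : ∀ X i, ∃ (κ : ℤˣ × {A // A ∈ S.powerset}) (y : ℤ), X ∈ T →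
      X + c i = (κ.1 : ℤ) * (∏ p ∈ κ.2.1, (p : ℤ)) * y ^ 2 := by
    intro X i
    by_cases hX : X ∈ T
    · obtain ⟨κ, y, h⟩ := exists_eq_unit_mul_prod_mul_sq (hT X hX i).1 (hT X hX i).2
      exact ⟨κ, y, fun _ => h⟩
    · exact ⟨(1, ⟨∅, by simp⟩), 0, fun h => absurd h hX⟩
  choose κ y hκ using hex
  let z : ℤ → Fin 3 → L := fun X i => r (κ X i) * (y X i : L)
  have hz : ∀ X ∈ T, ∀ i, z X i ^ 2 = ((X + c i : ℤ) : L) := by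
    intro X hX i
    simp only [z]
    rw [mul_pow, hr, hκ X i hX]
    push_cast
    ring
  have hw : ∀ X i, (X + c (i + 1)) - (X + c (i + 2)) = c (i + 1) - c (i + 2) := fun X i => by ring
  have hsq : ∀ X ∈ T, IsSqTriple (fun i => c (i + 1) - c (i + 2)) (z X) := fun X hX =>
    ⟨fun i => X + c i, hz X hX, hw X⟩
  rw [← Finset.card_filter_add_card_filter_not (fun X => maxHeight (logVec P (z X)) < 6)]
  refine add_le_add ?_ ?_
  · refine (card_le_of_small P hS h2S hc hcS _ (fun X i => X + c i) z
      (fun X hX => hz X (Finset.mem_filter.1 hX).1) hw (fun X => by rw [hc0, add_zero])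
      (B := 107000000000) fun X hX => ?_).trans (by norm_num)
    have h := (exp_lt_of_small (Finset.mem_filter.1 hX).2).le
    exact_mod_cast h
  · have hcard : (Finset.univ : Finset (Fin 3 → ℤˣ × {A // A ∈ S.powerset})).card =
        (2 * 2 ^ S.card) ^ 3 := by
      rw [Finset.card_univ, Fintype.card_fun, Fintype.card_prod, Fintype.card_coe,
        Finset.card_powerset]
      simp
    rw [← hcard]
    refine Finset.card_le_mul_card_image_of_maps_to (f := fun X => κ X)
      (fun X _ => Finset.mem_univ _) _ fun ν _ => ?_
    have hmem : ∀ X ∈ (T.filter fun X => ¬ maxHeight (logVec P (z X)) < 6).filter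
        (fun X => κ X = ν), X ∈ T ∧ 6 ≤ maxHeight (logVec P (z X)) ∧ κ X = ν := by
      intro X hX
      rw [Finset.mem_filter, Finset.mem_filter, not_lt] at hX
      exact ⟨hX.1.1, hX.1.2, hX.2⟩
    refine card_le_of_hasSigns P hS hc hcS (τ := fun g i => u (ν i) g) _ z
      (fun X hX => hsq X (hmem X hX).1) (fun X hX g i => ?_) (fun X hX => (hmem X hX).2.1) ?_
    · simp only [z]
      rw [(hmem X hX).2.2, map_mul, hu, map_intCast, mul_assoc]
    · intro X hX X' hX' hne h
      rw [hz X (hmem X hX).1, hz X' (hmem X' hX').1, Int.cast_inj, add_left_inj] at h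
      exact hne h

theorem exists_isGalois_isAlgClosed : ∃ (L : Type) (_ : Field L) (_ : Algebra ℚ L),
    IsGalois ℚ L ∧ IsAlgClosed L := by
  let : Algebra ℚ (AlgebraicClosure ℚ) := AlgebraicClosure.instAlgebra ℚ
  refine ⟨AlgebraicClosure ℚ, inferInstance, AlgebraicClosure.instAlgebra ℚ, ?_, inferInstance⟩
  infer_instance

theorem card_le_of_even_factorization {S : Finset ℕ} (hS : ∀ p ∈ S, p.Prime) (h2S : 2 ∈ S)
    (c : Fin 3 → ℤ) (hc0 : c 0 = 0) (hc : ∀ i, c (i + 1) - c (i + 2) ≠ 0)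
    (hcS : ∀ i, (c (i + 1) - c (i + 2)).natAbs.primeFactors ⊆ S) (T : Finset ℤ)
    (hT : ∀ X ∈ T, ∀ i, X + c i ≠ 0 ∧
      ∀ p : ℕ, p.Prime → p ∉ S → Even ((X + c i).natAbs.factorization p)) :
    T.card ≤ 214000000001 ^ 2 + 8 * 101 ^ (3 * S.card + 4) * (2 * 2 ^ S.card) ^ 3 := by
  obtain ⟨L, _, _, h1, h2⟩ := exists_isGalois_isAlgClosed
  exact card_le_of_even_factorization_aux L hS h2S c hc0 hc hcS T hT

end SquareClasses

section Counting

theorem Set.finite_and_ncard_le {X : Type*} {A : Set X} {N : ℕ}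
    (h : ∀ U : Finset X, (U : Set X) ⊆ A → U.card ≤ N) : A.Finite ∧ A.ncard ≤ N := by
  have hfin : A.Finite := by
    by_contra hinf
    obtain ⟨U, hU, hcard⟩ := Set.Infinite.exists_subset_card_eq hinf (N + 1)
    have := h U hU
    omega
  refine ⟨hfin, ?_⟩
  rw [Set.ncard_eq_toFinset_card A hfin]
  exact h _ (by simp)

theorem count_le_pow {s : ℕ} (hs : 2 ≤ s) :
    2 * (3 + (214000000001 ^ 2 + 8 * 101 ^ (3 * s + 4) * (2 * 2 ^ s) ^ 3)) ≤ 7 ^ (13 + 9 * s) := by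
  induction s, hs using Nat.le_induction with
  | base => norm_num
  | succ s _ ih =>
    have e1 : 101 ^ (3 * (s + 1) + 4) = 1030301 * 101 ^ (3 * s + 4) := by
      rw [show 3 * (s + 1) + 4 = 3 * s + 4 + 3 by ring, pow_add]
      norm_num [mul_comm]
    have e2 : (2 * 2 ^ (s + 1)) ^ 3 = 8 * (2 * 2 ^ s) ^ 3 := by ring
    have e3 : 7 ^ (13 + 9 * (s + 1)) = 40353607 * 7 ^ (13 + 9 * s) := by
      rw [show 13 + 9 * (s + 1) = 13 + 9 * s + 9 by ring, pow_add]
      norm_num [mul_comm]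
    have e4 : 8 * 101 ^ (3 * (s + 1) + 4) * (2 * 2 ^ (s + 1)) ^ 3 =
        8242408 * (8 * 101 ^ (3 * s + 4) * (2 * 2 ^ s) ^ 3) := by
      rw [e1, e2]
      ring
    rw [e3, e4]
    generalize 8 * 101 ^ (3 * s + 4) * (2 * 2 ^ s) ^ 3 = t at ih ⊢
    omega

variable {κ : Type*} [Fintype κ] {a : κ → ℤ} {S : Finset ℕ}

theorem even_factorization_of_sq_eq_prod (haS : ∀ i j, i ≠ j → ∀ p : ℕ, p.Prime →
      (p : ℤ) ∣ a i - a j → p ∈ S) {X Y : ℤ} (h : Y ^ 2 = ∏ i, (X + a i)) {i : κ}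
    (hi : X + a i ≠ 0) {p : ℕ} (hp : p.Prime) (hpS : p ∉ S) :
    Even ((X + a i).natAbs.factorization p) := by
  by_cases hpi : (p : ℤ) ∣ X + a i
  swap
  · rw [Nat.factorization_eq_zero_of_not_dvd fun hd => hpi (Int.natCast_dvd.2 hd)]
    exact Even.zero
  have hpj : ∀ j, j ≠ i → ¬ (p : ℤ) ∣ X + a j := by
    intro j hj hd
    refine hpS (haS j i hj p hp ?_)
    have := dvd_sub hd hpi
    rwa [add_sub_add_left_eq_sub] at this
  have hrest : ¬ (p : ℤ) ∣ ∏ j ∈ Finset.univ.erase i, (X + a j) := by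
    rw [(Nat.prime_iff_prime_int.1 hp).dvd_finsetProd_iff]
    rintro ⟨j, hj, hd⟩
    exact hpj j (Finset.ne_of_mem_erase hj) hd
  rw [← Finset.mul_prod_erase Finset.univ _ (Finset.mem_univ i)] at h
  have hrest0 : ∏ j ∈ Finset.univ.erase i, (X + a j) ≠ 0 := fun h0 => hrest (by rw [h0]; exact dvd_zero _)
  have h1 := congrArg (fun n : ℤ => n.natAbs.factorization p) h
  simp only [Int.natAbs_pow, Int.natAbs_mul] at h1
  rw [Nat.factorization_mul (Int.natAbs_ne_zero.2 hi) (Int.natAbs_ne_zero.2 hrest0),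
    Nat.factorization_pow, Finsupp.add_apply,
    Nat.factorization_eq_zero_of_not_dvd fun hd => hrest (Int.natCast_dvd.2 hd), add_zero] at h1
  rw [← h1]
  simp

theorem mem_of_card_lt (haS : ∀ i j, i ≠ j → ∀ p : ℕ, p.Prime → (p : ℤ) ∣ a i - a j → p ∈ S)
    {p : ℕ} (hp : p.Prime) (hcard : p < Fintype.card κ) : p ∈ S := by
  have : NeZero p := ⟨hp.ne_zero⟩
  obtain ⟨i, j, hij, h⟩ := Fintype.exists_ne_map_eq_of_card_lt (fun i => (a i : ZMod p))
    (by rwa [ZMod.card])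
  refine haS i j hij p hp ?_
  rw [← ZMod.intCast_zmod_eq_zero_iff_dvd]
  push_cast
  exact sub_eq_zero.2 h

theorem card_le_of_sq_eq_prod (hS : ∀ p ∈ S, p.Prime) (ha : Function.Injective a)
    (haS : ∀ i j, i ≠ j → ∀ p : ℕ, p.Prime → (p : ℤ) ∣ a i - a j → p ∈ S)
    (ι : Fin 3 ↪ κ) (hι : a (ι 0) = 0) (hcard : 3 < Fintype.card κ) :
    {q : ℤ × ℤ | q.2 ^ 2 = ∏ i, (q.1 + a i)}.Finite ∧
    {q : ℤ × ℤ | q.2 ^ 2 = ∏ i, (q.1 + a i)}.ncard ≤ 7 ^ (13 + 9 * S.card) := by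
  have h2S : 2 ∈ S := mem_of_card_lt haS Nat.prime_two (by omega)
  have h3S : 3 ∈ S := mem_of_card_lt haS Nat.prime_three hcard
  have hs : 2 ≤ S.card := by
    have h : ({2, 3} : Finset ℕ) ⊆ S := by
      intro x hx
      rw [Finset.mem_insert, Finset.mem_singleton] at hx
      rcases hx with rfl | rfl <;> assumption
    exact Finset.card_le_card h
  have hidx : ∀ i : Fin 3, ι (i + 1) ≠ ι (i + 2) := by
    intro i h
    have := ι.injective h
    revert this
    fin_cases i <;> decide
  refine Set.finite_and_ncard_le fun U hU => le_trans ?_ (count_le_pow hs)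
  have hfib : U.card ≤ 2 * (U.image Prod.fst).card := by
    refine Finset.card_le_mul_card_image U 2 fun X hX => ?_
    obtain ⟨q, hq, rfl⟩ := Finset.mem_image.1 hX
    refine (Finset.card_le_card (t := {(q.1, q.2), (q.1, -q.2)}) ?_).trans Finset.card_le_two
    intro q' hq'
    rw [Finset.mem_filter] at hq'
    have h1 : q.2 ^ 2 = ∏ i, (q.1 + a i) := hU hq
    have h2 : q'.2 ^ 2 = ∏ i, (q'.1 + a i) := hU hq'.1
    rw [hq'.2, ← h1] at h2
    rw [Finset.mem_insert, Finset.mem_singleton]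
    rcases sq_eq_sq_iff_eq_or_eq_neg.1 h2 with h | h
    · exact Or.inl (Prod.ext hq'.2 h)
    · exact Or.inr (Prod.ext hq'.2 h)
  refine hfib.trans (Nat.mul_le_mul_left 2 ?_)
  rw [← Finset.card_filter_add_card_filter_not (fun X => ∃ i, X + a (ι i) = 0)]
  refine add_le_add ?_ (card_le_of_even_factorization hS h2S (fun i => a (ι i)) hι ?_ ?_ _ ?_)
  · refine (Finset.card_le_card (t := Finset.univ.image fun i : Fin 3 => -a (ι i)) ?_).trans
      (Finset.card_image_le.trans (by simp))
    intro X hX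
    obtain ⟨i, hi⟩ := (Finset.mem_filter.1 hX).2
    exact Finset.mem_image.2 ⟨i, Finset.mem_univ _, by linarith⟩
  · intro i
    exact sub_ne_zero.2 fun h => hidx i (ha h)
  · intro i p hp
    exact haS _ _ (hidx i) p (Nat.prime_of_mem_primeFactors hp)
      (Int.natCast_dvd.2 (Nat.dvd_of_mem_primeFactors hp))
  · intro X hX i
    rw [Finset.mem_filter] at hX
    obtain ⟨q, hq, rfl⟩ := Finset.mem_image.1 hX.1
    have hi : q.1 + a (ι i) ≠ 0 := fun h => hX.2 ⟨i, h⟩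
    exact ⟨hi, fun p hp hpS => even_factorization_of_sq_eq_prod haS (hU hq) hi hp hpS⟩

end Counting

theorem stmt8 (k : ℕ) (hk : 3 ≤ k) (α : Fin k → ℤ)
    (hpos : ∀ i, 0 < α i) (hmono : StrictMono α) :
    ({p : ℤ × ℤ | p.2 ^ 2 = p.1 * ∏ i, (p.1 + α i)}).Finite ∧
    ({p : ℤ × ℤ | p.2 ^ 2 = p.1 * ∏ i, (p.1 + α i)}).ncard ≤
      7 ^ (13 + 9 *
        ((((∏ i, (α i) ^ 2) *
            ∏ p ∈ Finset.univ.filter fun p : Fin k × Fin k => p.1 < p.2,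
              (α p.2 - α p.1) ^ 2).natAbs).primeFactors.card)) := by
  set D := (∏ i, (α i) ^ 2) * ∏ p ∈ Finset.univ.filter fun p : Fin k × Fin k => p.1 < p.2,
    (α p.2 - α p.1) ^ 2 with hD
  have hD0 : D ≠ 0 := by
    refine mul_ne_zero (Finset.prod_ne_zero_iff.2 fun i _ => pow_ne_zero 2 (hpos i).ne')
      (Finset.prod_ne_zero_iff.2 fun p hp => pow_ne_zero 2 (sub_ne_zero.2 fun h => ?_))
    exact (Finset.mem_filter.1 hp).2.ne' (hmono.injective h)
  have hroot : ∀ i, α i ∣ D := fun i =>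
    ((dvd_pow_self _ two_ne_zero).trans (Finset.dvd_prod_of_mem (fun i => α i ^ 2)
      (Finset.mem_univ i))).mul_right _
  have hlt : ∀ i j, i < j → α j - α i ∣ D := fun i j hij =>
    ((dvd_pow_self _ two_ne_zero).trans (Finset.dvd_prod_of_mem
      (fun p : Fin k × Fin k => (α p.2 - α p.1) ^ 2) (a := (i, j)) (by simpa using hij))).mul_left _
  have ha : Function.Injective (fun o : Option (Fin k) => o.elim 0 α) := by
    rintro (_ | i) (_ | j) h
    · rfl
    · exact absurd h (hpos j).ne
    · exact absurd h (hpos i).ne'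
    · exact congrArg some (hmono.injective h)
  have hdvd : ∀ o o' : Option (Fin k), o ≠ o' → o.elim 0 α - o'.elim 0 α ∣ D := by
    rintro (_ | i) (_ | j) h
    · exact absurd rfl h
    · simpa using hroot j
    · simpa using hroot i
    · rcases lt_trichotomy i j with hij | rfl | hij
      · have := hlt i j hij
        rw [← neg_sub, neg_dvd] at this
        exact this
      · exact absurd rfl h
      · exact hlt j i hij
  have hι : Function.Injective (fun i : Fin 3 =>
      (if h : i = 0 then none else some ⟨i, by omega⟩ : Option (Fin k))) := by
    intro i j h
    dsimp only at h
    split_ifs at h with hi hj hj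
    · rw [hi, hj]
    · exact Fin.ext (Fin.mk.inj_iff.1 (Option.some.inj h))
  have h := card_le_of_sq_eq_prod (a := fun o : Option (Fin k) => o.elim 0 α)
    (S := D.natAbs.primeFactors) (fun p hp => Nat.prime_of_mem_primeFactors hp) ha
    (fun o o' hoo p hp hd => Nat.mem_primeFactors.2 ⟨hp,
      Int.natCast_dvd.1 (hd.trans (hdvd o o' hoo)), Int.natAbs_ne_zero.2 hD0⟩)
    ⟨_, hι⟩ rfl (by rw [Fintype.card_option, Fintype.card_fin]; omega)
  simpa [Fintype.prod_option] using h
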